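/- arXiv:math/0009065 — 2 statements merged into one kernel-verified Lean document; each statement's English description precedes it below -/
import Mathlib

section
/- Let K₊(x,t) be as above. For each p ≥ 2, ‖∫ K₊(x−y,t) g(y) dy‖_{L^p_x(ℝ)} ≤ c |t|^{−(1/(2j+1))(1/p' − 1/p)⁻¹-type exponent, precisely c |t|^{−(1/(2j+1))(1 − 2/p)}... stated exactly: ‖K₊(·,t) * g‖_{L^p(ℝ)} ≤ c |t|^{−(1/(2j+1))(1/p' − 1/p)} ‖g‖_{L^{p'}(ℝ)}, where 1/p + 1/p' = 1. -/
open MeasureTheory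

open Classical in
/-- The kernel `K₊(x,t) = 𝟙_{t≥0}(t) ∫ e^{ixξ - tP(iξ)} 𝟙_{Re P(iξ) ≥ 0}(ξ) dξ`
with `P(z) = (z-1)^{2j+1}`. -/
noncomputable def Kplus (j : ℕ) (x t : ℝ) : ℂ :=
  if 0 ≤ t then
    ∫ ξ : ℝ,
      if 0 ≤ ((Complex.I * (ξ : ℂ) - 1) ^ (2 * j + 1)).re then
        Complex.exp (Complex.I * (x : ℂ) * (ξ : ℂ) -
          (t : ℂ) * (Complex.I * (ξ : ℂ) - 1) ^ (2 * j + 1))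
      else 0
  else 0

open scoped FourierTransform ContDiff

theorem integral_fourier_mul_eq_flip {f g : ℝ → ℂ} (hf : Integrable f) (hg : Integrable g) :
    ∫ ξ, 𝓕 f ξ * g ξ = ∫ x, f x * 𝓕 g x := by
  have h := VectorFourier.integral_bilin_fourierIntegral_eq_flip (L := innerₗ ℝ)
    (ContinuousLinearMap.mul ℂ ℂ) Real.continuous_fourierChar continuous_inner hf hg
  rwa [flip_innerₗ] at h

theorem fourier_memLp_two_toLp_ae_eq {f : ℝ → ℂ} (hf : Integrable f) (hf2 : MemLp f 2) :
    𝓕 f =ᵐ[volume] (𝓕 (hf2.toLp f) : Lp ℂ 2 (volume : Measure ℝ)) := by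
  have hcont : Continuous (𝓕 f) :=
    VectorFourier.fourierIntegral_continuous (L := innerₗ ℝ) Real.continuous_fourierChar
      continuous_inner hf
  apply ae_eq_of_integral_contDiff_smul_eq hcont.locallyIntegrable
    ((Lp.memLp _).locallyIntegrable (by norm_num))
  intro g g_smooth g_cpt
  have hg₁ : HasCompactSupport (Complex.ofRealCLM ∘ g) := g_cpt.comp_left rfl
  have hg₂ : ContDiff ℝ ∞ (Complex.ofRealCLM ∘ g) := by fun_prop
  have key := congrArg (fun T => T (hg₁.toSchwartzMap hg₂))
    (Lp.fourier_toTemperedDistribution_eq (hf2.toLp f))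
  simp only [TemperedDistribution.fourier_apply, Lp.toTemperedDistribution_apply] at key
  set G := hg₁.toSchwartzMap hg₂
  have hG : ∀ x, G x = (g x : ℂ) := fun x => rfl
  calc ∫ x, g x • 𝓕 f x = ∫ x, 𝓕 f x * G x := by
        congr 1; ext x; rw [hG, Complex.real_smul, mul_comm]
    _ = ∫ x, f x * 𝓕 (G : ℝ → ℂ) x := integral_fourier_mul_eq_flip hf G.integrable
    _ = ∫ x, (𝓕 G) x • (hf2.toLp f) x := by
        apply integral_congr_ae
        filter_upwards [hf2.coeFn_toLp] with x hx
        rw [hx, smul_eq_mul, mul_comm, SchwartzMap.fourier_coe]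
    _ = _ := by
        rw [key]
        congr 1

theorem eLpNorm_two_fourier {f : ℝ → ℂ} (hf : Integrable f) (hf2 : MemLp f 2) :
    eLpNorm (𝓕 f) 2 volume = eLpNorm f 2 volume := by
  rw [eLpNorm_congr_ae (fourier_memLp_two_toLp_ae_eq hf hf2),
    ← eLpNorm_congr_ae hf2.coeFn_toLp, ← Lp.enorm_def, ← Lp.enorm_def, ← ofReal_norm,
    ← ofReal_norm, Lp.norm_fourier_eq]

theorem eLpNorm_two_fourierInv {f : ℝ → ℂ} (hf : Integrable f) (hf2 : MemLp f 2) :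
    eLpNorm (𝓕⁻ f) 2 volume = eLpNorm f 2 volume := by
  rw [← eLpNorm_two_fourier hf hf2]
  have : 𝓕⁻ f = 𝓕 f ∘ Neg.neg := by
    ext x; exact Real.fourierInv_eq_fourier_neg f x
  have hcont : Continuous (𝓕 f) :=
    VectorFourier.fourierIntegral_continuous (L := innerₗ ℝ) Real.continuous_fourierChar
      continuous_inner hf
  rw [this]
  exact eLpNorm_comp_measurePreserving hcont.aestronglyMeasurable
    (Measure.measurePreserving_neg volume)

theorem integral_fourierInv_sub_mul {A φ : ℝ → ℂ} (hA : Integrable A) (hφ : Integrable φ) (x : ℝ) :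
    ∫ y, 𝓕⁻ A (x - y) * φ y = 𝓕⁻ (fun η => A η * 𝓕 φ η) x := by
  have hB : Integrable (fun η : ℝ => ((Real.fourierChar (η * x) : Circle) : ℂ) * A η) := by
    have hc : Continuous (fun η : ℝ => ((Real.fourierChar (η * x) : Circle) : ℂ)) :=
      by
      have := Real.continuous_fourierChar
      fun_prop
    refine hA.bdd_mul (c := 1) hc.aestronglyMeasurable ?_
    · filter_upwards with η using (Circle.norm_coe _).le
  have h := integral_fourier_mul_eq_flip hB hφ
  calc ∫ y, 𝓕⁻ A (x - y) * φ y
      = ∫ y, 𝓕 (fun η : ℝ => ((Real.fourierChar (η * x) : Circle) : ℂ) * A η) y * φ y := by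
        congr 1; ext y
        congr 1
        rw [Real.fourierInv_eq, Real.fourier_real_eq]
        congr 1; ext η
        simp only [Circle.smul_def, smul_eq_mul, ← mul_assoc, ← Circle.coe_mul,
          ← AddChar.map_add_eq_mul]
        congr 3
        simp
        ring
    _ = _ := h
    _ = _ := by
        rw [Real.fourierInv_eq]
        congr 1; ext η
        simp only [Circle.smul_def, smul_eq_mul, ← mul_assoc]
        congr 4
        simp [mul_comm]

theorem eLpNorm_two_convolution_fourierInv_le {A φ : ℝ → ℂ} {C : ℝ} (hA : Integrable A)
    (hC : ∀ η, ‖A η‖ ≤ C) (hφ : Integrable φ) (hφ2 : MemLp φ 2) :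
    eLpNorm (fun x => ∫ y, 𝓕⁻ A (x - y) * φ y) 2 volume ≤
      ENNReal.ofReal C * eLpNorm φ 2 volume := by
  simp_rw [integral_fourierInv_sub_mul hA hφ]
  have hcont : Continuous (𝓕 φ) :=
    VectorFourier.fourierIntegral_continuous (L := innerₗ ℝ) Real.continuous_fourierChar
      continuous_inner hφ
  have hF2 : MemLp (𝓕 φ) 2 :=
    ⟨hcont.aestronglyMeasurable, by rw [eLpNorm_two_fourier hφ hφ2]; exact hφ2.2⟩
  have hint : Integrable (fun η => A η * 𝓕 φ η) := by
    refine hA.mul_bdd (c := ∫ v, ‖φ v‖) hcont.aestronglyMeasurable ?_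
    filter_upwards with η
    exact VectorFourier.norm_fourierIntegral_le_integral_norm _ _ _ _ _
  have hle : eLpNorm (fun η => A η * 𝓕 φ η) 2 volume ≤
      ENNReal.ofReal C * eLpNorm (𝓕 φ) 2 volume := by
    apply eLpNorm_le_mul_eLpNorm_of_ae_le_mul
    filter_upwards with η
    rw [norm_mul]
    gcongr
    exact hC η
  have hint2 : MemLp (fun η => A η * 𝓕 φ η) 2 :=
    ⟨hint.aestronglyMeasurable, hle.trans_lt (ENNReal.mul_lt_top (by simp) hF2.2)⟩
  rw [eLpNorm_two_fourierInv hint hint2, ← eLpNorm_two_fourier hφ hφ2]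
  exact hle

theorem integral_inv_one_add_div_sq {δ : ℝ} (hδ : 0 < δ) (a : ℝ) :
    Integrable (fun ξ : ℝ => (1 + ((ξ - a) / δ) ^ 2)⁻¹) ∧
      ∫ ξ : ℝ, (1 + ((ξ - a) / δ) ^ 2)⁻¹ = Real.pi * δ := by
  constructor
  · exact (integrable_inv_one_add_sq.comp_div hδ.ne').comp_sub_right a
  · rw [integral_sub_right_eq_self (fun ξ : ℝ => (1 + (ξ / δ) ^ 2)⁻¹) a,
      Measure.integral_comp_div (fun ξ : ℝ => (1 + ξ ^ 2)⁻¹) δ, integral_univ_inv_one_add_sq,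
      abs_of_pos hδ, smul_eq_mul, mul_comm]

/-- A smooth substitute for `1 / (ξ - z)` at scale `δ`. -/
theorem exists_regularized_inv_sub {δ : ℝ} (hδ : 0 < δ) (z : ℂ) :
    ∃ m m' : ℝ → ℂ, (∀ ξ, HasDerivAt m (m' ξ) ξ) ∧ Continuous m' ∧ (∀ ξ, ‖m ξ‖ ≤ δ⁻¹) ∧
      (∀ ξ, ‖m' ξ‖ ≤ 3 * (δ ^ 2)⁻¹ * (1 + ((ξ - z.re) / δ) ^ 2)⁻¹) ∧
      (∀ ξ : ℝ, ‖m ξ * (ξ - z)‖ ≤ 1) ∧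
      (∀ ξ : ℝ, ‖1 - m ξ * (ξ - z)‖ ≤ (1 + ((ξ - z.re) / δ) ^ 2)⁻¹) := by
  set D : ℝ → ℝ := fun ξ => (ξ - z.re) ^ 2 + z.im ^ 2 + δ ^ 2 with hD
  have hDpos : ∀ ξ, 0 < D ξ := fun ξ => by positivity
  have hDne : ∀ ξ, (D ξ : ℂ) ≠ 0 := fun ξ => by exact_mod_cast (hDpos ξ).ne'
  have hDderiv : ∀ ξ, HasDerivAt D (2 * (ξ - z.re)) ξ := fun ξ => by
    have h := (((hasDerivAt_id ξ).sub_const z.re).pow 2).add_const (z.im ^ 2) |>.add_const (δ ^ 2)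
    convert! h using 1
    simp
  have hDcont : Continuous D := by fun_prop
  have hconj : ∀ ξ : ℝ, ‖(ξ : ℂ) - star z‖ ^ 2 = (ξ - z.re) ^ 2 + z.im ^ 2 := fun ξ => by
    rw [← Complex.normSq_eq_norm_sq, Complex.normSq_apply]; simp; ring
  have hw : ∀ ξ : ℝ, δ ^ 2 / D ξ ≤ (1 + ((ξ - z.re) / δ) ^ 2)⁻¹ := fun ξ => by
    rw [show (1 + ((ξ - z.re) / δ) ^ 2)⁻¹ = δ ^ 2 / ((ξ - z.re) ^ 2 + δ ^ 2) by
      field_simp; ring]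
    apply div_le_div_of_nonneg_left (by positivity) (by positivity)
    simp only [hD]; nlinarith [sq_nonneg z.im]
  have hmul : ∀ ξ : ℝ, ((ξ : ℂ) - star z) / D ξ * (ξ - z) = ((1 - δ ^ 2 / D ξ : ℝ) : ℂ) := fun ξ => by
    have h1 : ((ξ : ℂ) - star z) * (ξ - z) = ((D ξ - δ ^ 2 : ℝ) : ℂ) := by
      apply Complex.ext <;> simp [hD, sq]; ring
    rw [div_mul_eq_mul_div, h1, one_sub_div (hDpos ξ).ne']; push_cast; rfl
  have hfrac : ∀ ξ, 0 ≤ δ ^ 2 / D ξ ∧ δ ^ 2 / D ξ ≤ 1 := fun ξ => by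
    refine ⟨by have := hDpos ξ; positivity, (div_le_one (hDpos ξ)).2 ?_⟩
    simp only [hD]; nlinarith [sq_nonneg z.im, sq_nonneg (ξ - z.re)]
  refine ⟨fun ξ => ((ξ : ℂ) - star z) / D ξ,
    fun ξ => (1 * (D ξ : ℂ) - ((ξ : ℂ) - star z) * ((2 * (ξ - z.re) : ℝ) : ℂ)) / (D ξ : ℂ) ^ 2,
    fun ξ => ?_, ?_, fun ξ => ?_, fun ξ => ?_, fun ξ => ?_, fun ξ => ?_⟩
  · exact ((Complex.ofRealCLM.hasDerivAt (x := ξ)).sub_const (star z)).div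
      ((hDderiv ξ).ofReal_comp) (hDne ξ)
  · apply Continuous.div (by fun_prop) (by fun_prop)
    exact fun ξ => pow_ne_zero 2 (hDne ξ)
  · rw [norm_div, Complex.norm_real, Real.norm_of_nonneg (hDpos ξ).le, div_le_iff₀ (hDpos ξ),
      inv_mul_eq_div, le_div_iff₀ hδ]
    have := hconj ξ
    simp only [hD]
    nlinarith [sq_nonneg (‖(ξ : ℂ) - star z‖ - δ), sq_nonneg ‖(ξ : ℂ) - star z‖]
  · have h1 : ‖((ξ : ℂ) - star z)‖ * |ξ - z.re| ≤ D ξ := by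
      have := hconj ξ
      have h3 := sq_abs (ξ - z.re)
      simp only [hD]
      nlinarith [sq_nonneg (‖(ξ : ℂ) - star z‖ - |ξ - z.re|), sq_nonneg z.im, sq_nonneg δ]
    calc _ ≤ 3 * D ξ / D ξ ^ 2 := by
          rw [norm_div, norm_pow, Complex.norm_real, Real.norm_of_nonneg (hDpos ξ).le]
          gcongr
          refine (norm_sub_le _ _).trans ?_
          rw [one_mul, norm_mul, Complex.norm_real, Complex.norm_real,
            Real.norm_of_nonneg (hDpos ξ).le, Real.norm_eq_abs, abs_mul, abs_two]
          linarith
      _ = 3 * (δ ^ 2)⁻¹ * (δ ^ 2 / D ξ) := by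
          have := (hDpos ξ).ne'
          field_simp
      _ ≤ _ := by gcongr; exact hw ξ
  · rw [hmul, Complex.norm_real, Real.norm_eq_abs, abs_le]
    constructor <;> linarith [(hfrac ξ).1, (hfrac ξ).2]
  · rw [hmul, ← Complex.ofReal_one, ← Complex.ofReal_sub, Complex.norm_real, sub_sub_cancel,
      Real.norm_of_nonneg (hfrac ξ).1]
    exact hw ξ

/-- A smooth substitute for `1 / ∏ (ξ - z)` at scale `δ`. -/
theorem exists_regularized_inv_prod {δ : ℝ} (hδ : 0 < δ) (s : Multiset ℂ) :
    ∃ (h h' : ℝ → ℂ) (w : ℝ → ℝ), (∀ ξ, HasDerivAt h (h' ξ) ξ) ∧ Continuous h' ∧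
      (∀ ξ, ‖h ξ‖ ≤ (δ ^ s.card)⁻¹) ∧
      (∀ ξ, ‖h' ξ‖ ≤ 3 * (δ ^ (s.card + 1))⁻¹ * w ξ) ∧
      (∀ ξ : ℝ, ‖h ξ * (s.map fun z => (ξ : ℂ) - z).prod‖ ≤ 1) ∧
      (∀ ξ : ℝ, ‖1 - h ξ * (s.map fun z => (ξ : ℂ) - z).prod‖ ≤ w ξ) ∧
      Integrable w ∧ ∫ ξ, w ξ = s.card * (Real.pi * δ) := by
  induction s using Multiset.induction_on with
  | empty =>
    exact ⟨fun _ => 1, fun _ => 0, fun _ => 0, fun ξ => hasDerivAt_const ξ 1, continuous_const,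
      by simp, by simp, by simp, by simp, by simp, by simp⟩
  | cons z s ih =>
    obtain ⟨h, h', w, hd, hc, hn, hn', hp, hw, hwi, hwI⟩ := ih
    obtain ⟨m, m', md, mc, mn, mn', mp, mw⟩ := exists_regularized_inv_sub hδ z
    obtain ⟨ei, eI⟩ := integral_inv_one_add_div_sq hδ z.re
    have hcont : Continuous h := continuous_iff_continuousAt.2 fun ξ => (hd ξ).continuousAt
    have mcont : Continuous m := continuous_iff_continuousAt.2 fun ξ => (md ξ).continuousAt
    refine ⟨fun ξ => m ξ * h ξ, fun ξ => m' ξ * h ξ + m ξ * h' ξ,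
      fun ξ => (1 + ((ξ - z.re) / δ) ^ 2)⁻¹ + w ξ, fun ξ => (md ξ).mul (hd ξ), by fun_prop,
      fun ξ => ?_, fun ξ => ?_, fun ξ => ?_, fun ξ => ?_, ei.add hwi, ?_⟩
    · rw [norm_mul, Multiset.card_cons, pow_succ', mul_inv]
      gcongr
      exacts [mn ξ, hn ξ]
    · have h0 : 0 ≤ w ξ := (norm_nonneg _).trans (hw ξ)
      calc _ ≤ ‖m' ξ‖ * ‖h ξ‖ + ‖m ξ‖ * ‖h' ξ‖ := by
            simpa only [norm_mul] using norm_add_le (m' ξ * h ξ) (m ξ * h' ξ)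
        _ ≤ (3 * (δ ^ 2)⁻¹ * (1 + ((ξ - z.re) / δ) ^ 2)⁻¹) * (δ ^ s.card)⁻¹ +
            δ⁻¹ * (3 * (δ ^ (s.card + 1))⁻¹ * w ξ) := by
            gcongr
            exacts [mn' ξ, hn ξ, mn ξ, hn' ξ]
        _ = _ := by
            simp only [Multiset.card_cons]
            generalize (1 + ((ξ - z.re) / δ) ^ 2)⁻¹ = e
            simp only [pow_succ, mul_inv]
            ring
    · rw [Multiset.map_cons, Multiset.prod_cons, mul_mul_mul_comm, norm_mul]
      exact mul_le_one₀ (mp ξ) (norm_nonneg _) (hp ξ)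
    · rw [Multiset.map_cons, Multiset.prod_cons, mul_mul_mul_comm]
      set a := m ξ * (ξ - z)
      set b := h ξ * (s.map fun z => (ξ : ℂ) - z).prod
      calc ‖1 - a * b‖ = ‖(1 - a) + a * (1 - b)‖ := by congr 1; ring
        _ ≤ ‖1 - a‖ + ‖a‖ * ‖1 - b‖ := by
            simpa only [norm_mul] using norm_add_le (1 - a) (a * (1 - b))
        _ ≤ _ := by
            have h1 : ‖a‖ * ‖1 - b‖ ≤ ‖1 - b‖ :=
              mul_le_of_le_one_left (norm_nonneg _) (mp ξ)
            linarith [mw ξ, hw ξ]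
    · rw [integral_add ei hwi, eI, hwI, Multiset.card_cons]
      push_cast; ring

/-- A van der Corput type bound for complex polynomial phases with nonpositive real part. -/
theorem norm_integral_exp_polynomial_le {p : Polynomial ℂ} (hp : p.derivative ≠ 0) {δ a b : ℝ}
    (hδ : 0 < δ) (hab : a ≤ b) (hre : ∀ ξ ∈ Set.Icc a b, (p.eval (ξ : ℂ)).re ≤ 0) :
    ‖∫ ξ in a..b, Complex.exp (p.eval (ξ : ℂ))‖ ≤
      (2 + 3 * p.derivative.natDegree * Real.pi) *
          (‖p.derivative.leadingCoeff‖ * δ ^ p.derivative.natDegree)⁻¹ +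
        p.derivative.natDegree * Real.pi * δ := by
  set q := p.derivative with hq
  set L := q.leadingCoeff with hL
  have hL0 : L ≠ 0 := Polynomial.leadingCoeff_ne_zero.2 hp
  have hLpos : 0 < ‖L‖ := norm_pos_iff.2 hL0
  have hsplit : q.Splits := IsAlgClosed.splits q
  have hcard : q.roots.card = q.natDegree := hsplit.natDegree_eq_card_roots.symm
  have heval : ∀ ξ : ℝ, q.eval (ξ : ℂ) = L * (q.roots.map fun z => (ξ : ℂ) - z).prod := fun ξ =>
    hsplit.eval_eq_prod_roots _
  obtain ⟨h, h', w, hd, hc, hn, hn', hpr, hw, hwi, hwI⟩ := exists_regularized_inv_prod hδ q.roots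
  rw [hcard] at hn hn' hwI
  have hcont : Continuous h := continuous_iff_continuousAt.2 fun ξ => (hd ξ).continuousAt
  set E : ℝ → ℂ := fun ξ => Complex.exp (p.eval (ξ : ℂ)) with hE
  have hEd : ∀ ξ : ℝ, HasDerivAt E (E ξ * q.eval (ξ : ℂ)) ξ := fun ξ =>
    ((p.hasDerivAt (ξ : ℂ)).comp_ofReal).cexp
  have hEc : Continuous E := continuous_iff_continuousAt.2 fun ξ => (hEd ξ).continuousAt
  have hqc : Continuous fun ξ : ℝ => q.eval (ξ : ℂ) := q.continuous.comp Complex.continuous_ofReal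
  have hE1 : ∀ ξ ∈ Set.Icc a b, ‖E ξ‖ ≤ 1 := fun ξ hξ => by
    rw [hE, Complex.norm_exp]; exact Real.exp_le_one_iff.2 (hre ξ hξ)
  have hGd : ∀ ξ : ℝ, HasDerivAt (fun ξ => E ξ * (L⁻¹ * h ξ))
      (E ξ * q.eval (ξ : ℂ) * (L⁻¹ * h ξ) + E ξ * (L⁻¹ * h' ξ)) ξ := fun ξ =>
    (hEd ξ).mul ((hd ξ).const_mul L⁻¹)
  have hftc : ∫ ξ in a..b, (E ξ * q.eval (ξ : ℂ) * (L⁻¹ * h ξ) + E ξ * (L⁻¹ * h' ξ)) =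
      E b * (L⁻¹ * h b) - E a * (L⁻¹ * h a) :=
    intervalIntegral.integral_eq_sub_of_hasDerivAt (fun ξ _ => hGd ξ)
      (Continuous.intervalIntegrable (by fun_prop) _ _)
  have hrem : ∫ ξ in a..b, E ξ = (E b * (L⁻¹ * h b) - E a * (L⁻¹ * h a)) +
      ∫ ξ in a..b, (E ξ * (1 - L⁻¹ * h ξ * q.eval (ξ : ℂ)) - E ξ * (L⁻¹ * h' ξ)) := by
    rw [← hftc, ← intervalIntegral.integral_add
      (Continuous.intervalIntegrable (by fun_prop) _ _)
      (Continuous.intervalIntegrable (by fun_prop) _ _)]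
    congr 1; ext ξ; ring
  have hw0 : ∀ ξ, 0 ≤ w ξ := fun ξ => (norm_nonneg _).trans (hw ξ)
  set Mδ := (‖L‖ * δ ^ q.natDegree)⁻¹ with hMδ
  have hM0 : 0 < Mδ := by positivity
  have hbd : ∀ ξ ∈ Set.Icc a b, ‖E ξ * (L⁻¹ * h ξ)‖ ≤ Mδ := fun ξ hξ => by
    rw [norm_mul, norm_mul, norm_inv, hMδ, mul_inv]
    calc _ ≤ 1 * (‖L‖⁻¹ * (δ ^ q.natDegree)⁻¹) := by
          gcongr
          exacts [hE1 ξ hξ, hn ξ]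
      _ = _ := one_mul _
  have hint : ‖∫ ξ in a..b, (E ξ * (1 - L⁻¹ * h ξ * q.eval (ξ : ℂ)) - E ξ * (L⁻¹ * h' ξ))‖ ≤
      (1 + 3 * Mδ * δ⁻¹) * (q.natDegree * (Real.pi * δ)) := by
    have hpt : ∀ ξ ∈ Set.Icc a b,
        ‖E ξ * (1 - L⁻¹ * h ξ * q.eval (ξ : ℂ)) - E ξ * (L⁻¹ * h' ξ)‖ ≤
          (1 + 3 * Mδ * δ⁻¹) * w ξ := fun ξ hξ => by
      have e1 : L⁻¹ * h ξ * q.eval (ξ : ℂ) = h ξ * (q.roots.map fun z => (ξ : ℂ) - z).prod := by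
        rw [heval]; field_simp
      rw [← mul_sub, e1, norm_mul]
      have e2 : ‖L⁻¹ * h' ξ‖ ≤ 3 * Mδ * δ⁻¹ * w ξ := by
        rw [norm_mul, norm_inv]
        calc _ ≤ ‖L‖⁻¹ * (3 * (δ ^ (q.natDegree + 1))⁻¹ * w ξ) := by gcongr; exact hn' ξ
          _ = _ := by rw [hMδ, pow_succ, mul_inv, mul_inv]; ring
      calc _ ≤ 1 * (w ξ + 3 * Mδ * δ⁻¹ * w ξ) := by
            gcongr
            · exact hE1 ξ hξ
            · exact (norm_sub_le _ _).trans (add_le_add (hw ξ) e2)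
        _ = _ := by ring
    have hWi : Integrable fun ξ => (1 + 3 * Mδ * δ⁻¹) * w ξ := hwi.const_mul _
    calc _ ≤ ∫ ξ in a..b, (1 + 3 * Mδ * δ⁻¹) * w ξ :=
          intervalIntegral.norm_integral_le_of_norm_le hab
            (by filter_upwards with ξ hξ using hpt ξ ⟨hξ.1.le, hξ.2⟩) hWi.intervalIntegrable
      _ ≤ ∫ ξ, (1 + 3 * Mδ * δ⁻¹) * w ξ := by
          rw [intervalIntegral.integral_of_le hab]
          exact setIntegral_le_integral hWi
            (by filter_upwards with ξ using mul_nonneg (by positivity) (hw0 ξ))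
      _ = _ := by rw [integral_const_mul, hwI]
  rw [hrem]
  calc _ ≤ (Mδ + Mδ) + (1 + 3 * Mδ * δ⁻¹) * (q.natDegree * (Real.pi * δ)) := by
        refine (norm_add_le _ _).trans (add_le_add ((norm_sub_le _ _).trans (add_le_add ?_ ?_)) hint)
        · exact hbd b ⟨hab, le_rfl⟩
        · exact hbd a ⟨le_rfl, hab⟩
    _ = _ := by field_simp; ring

theorem norm_intervalIntegral_le_of_finset {f : ℝ → ℂ} (hf : ∀ a b, IntervalIntegrable f volume a b)
    {M : ℝ} (F : Finset ℝ) : ∀ a b : ℝ, a ≤ b →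
      (∀ c d, c ≤ d → (∀ x ∈ Set.Ioo c d, x ∉ F) → ‖∫ x in c..d, f x‖ ≤ M) →
      ‖∫ x in a..b, f x‖ ≤ 2 ^ F.card * M := by
  suffices H : ∀ a b : ℝ, a ≤ b →
      (∀ c d, a ≤ c → c ≤ d → d ≤ b → (∀ x ∈ Set.Ioo c d, x ∉ F) → ‖∫ x in c..d, f x‖ ≤ M) →
      ‖∫ x in a..b, f x‖ ≤ 2 ^ F.card * M from
    fun a b hab h => H a b hab fun c d _ hcd _ => h c d hcd
  induction F using Finset.induction_on with
  | empty => intro a b hab h; simpa using h a b le_rfl hab le_rfl (by simp)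
  | insert r F hr ih =>
    intro a b hab h
    have hM : 0 ≤ M := (norm_nonneg _).trans (h a a le_rfl le_rfl hab (by simp))
    rw [Finset.card_insert_of_notMem hr, pow_succ]
    by_cases hrab : r ∈ Set.Ioo a b
    · have h1 := ih a r hrab.1.le fun c d hac hcd hdr hF => h c d hac hcd (hdr.trans hrab.2.le)
        fun x hx => by
          simp only [Finset.mem_insert, not_or]
          exact ⟨(hx.2.trans_le hdr).ne, hF x hx⟩
      have h2 := ih r b hrab.2.le fun c d hac hcd hdr hF => h c d (hrab.1.le.trans hac) hcd hdr
        fun x hx => by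
          simp only [Finset.mem_insert, not_or]
          exact ⟨(hac.trans_lt hx.1).ne', hF x hx⟩
      rw [← intervalIntegral.integral_add_adjacent_intervals (hf a r) (hf r b)]
      linarith [norm_add_le (∫ x in a..r, f x) (∫ x in r..b, f x)]
    · have h1 := ih a b hab fun c d hac hcd hdb hF => h c d hac hcd hdb fun x hx => by
        simp only [Finset.mem_insert, not_or]
        refine ⟨?_, hF x hx⟩
        rintro rfl
        exact hrab ⟨hac.trans_lt hx.1, hx.2.trans_le hdb⟩
      have : 0 ≤ (2 : ℝ) ^ F.card * M := by positivity
      linarith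


theorem finite_setOf_re_I_mul_sub_one_pow_eq_zero (n : ℕ) :
    {ξ : ℝ | ((Complex.I * (ξ : ℂ) - 1) ^ (2 * n + 1)).re = 0}.Finite := by
  set R : Polynomial ℂ := (Polynomial.C Complex.I * Polynomial.X - 1) ^ (2 * n + 1) +
    (-Polynomial.C Complex.I * Polynomial.X - 1) ^ (2 * n + 1) with hR
  have heval : ∀ ξ : ℝ, R.eval (ξ : ℂ) =
      ((2 * ((Complex.I * (ξ : ℂ) - 1) ^ (2 * n + 1)).re : ℝ) : ℂ) := fun ξ => by
    rw [← Complex.add_conj]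
    simp [hR, -neg_mul]
  have hR0 : R ≠ 0 := fun h => by
    have := heval 0
    rw [h] at this
    simp [Odd.neg_one_pow (⟨n, rfl⟩ : Odd (2 * n + 1))] at this
  refine (R.roots.toFinset.finite_toSet.preimage Complex.ofReal_injective.injOn).subset ?_
  intro ξ hξ
  simp only [Set.mem_ofPred_eq] at hξ
  simp [hR0, Polynomial.IsRoot, heval, hξ]

open Polynomial in
/-- The exponent of the integrand of `Kplus` as a polynomial in `ξ`. -/
theorem exists_phase_polynomial {j : ℕ} {t : ℝ} (hj : 0 < j) (ht : 0 < t) (x : ℝ) :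
    ∃ p : Polynomial ℂ, (∀ ξ : ℝ, p.eval (ξ : ℂ) = Complex.I * (x : ℂ) * (ξ : ℂ) -
          (t : ℂ) * (Complex.I * (ξ : ℂ) - 1) ^ (2 * j + 1)) ∧
      p.derivative.natDegree = 2 * j ∧ t ≤ ‖p.derivative.leadingCoeff‖ := by
  refine ⟨C (Complex.I * x) * X - C (t : ℂ) * (C Complex.I * X - C 1) ^ (2 * j + 1),
    fun ξ => by simp, ?_⟩
  have hB : (C Complex.I * X - C 1 : ℂ[X]).natDegree = 1 := by
    rw [natDegree_sub_C, natDegree_C_mul_X _ Complex.I_ne_zero]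
  have hBl : (C Complex.I * X - C 1 : ℂ[X]).leadingCoeff = Complex.I := by
    rw [leadingCoeff, hB]; simp [coeff_one]
  set c : ℂ := -(t * (2 * j + 1) * Complex.I) with hc
  have hc0 : c ≠ 0 := by
    have h1 : (t : ℂ) ≠ 0 := by exact_mod_cast ht.ne'
    have h2 : (2 * j + 1 : ℂ) ≠ 0 := by exact_mod_cast (2 * j).succ_ne_zero
    simp [hc, h1, h2]
  have hd : derivative (C (Complex.I * x) * X - C (t : ℂ) * (C Complex.I * X - C 1) ^ (2 * j + 1)) =
      C c * (C Complex.I * X - C 1) ^ (2 * j) + C (Complex.I * x) := by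
    simp only [derivative_sub, derivative_C_mul, derivative_X, derivative_pow, derivative_C, hc]
    simp
    ring
  have hnd : (C c * (C Complex.I * X - C 1) ^ (2 * j) : ℂ[X]).natDegree = 2 * j := by
    rw [natDegree_C_mul hc0, natDegree_pow, hB, mul_one]
  rw [hd, Polynomial.natDegree_add_C, hnd, Polynomial.leadingCoeff_add_of_degree_lt']
  · refine ⟨rfl, ?_⟩
    rw [Polynomial.leadingCoeff_mul, Polynomial.leadingCoeff_pow, hBl, Polynomial.leadingCoeff_C]
    have h2 : ‖(2 * j + 1 : ℂ)‖ = 2 * j + 1 := by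
      have := Complex.norm_natCast (2 * j + 1)
      push_cast at this; exact this
    simp only [hc, norm_mul, norm_neg, norm_pow, Complex.norm_I, one_pow, mul_one,
      Complex.norm_real, Real.norm_of_nonneg ht.le, h2]
    have : (0 : ℝ) ≤ j := j.cast_nonneg
    nlinarith
  · refine (Polynomial.degree_C_le).trans_lt ?_
    apply Polynomial.natDegree_pos_iff_degree_pos.1
    rw [hnd]; omega

open Classical in
/-- The integrand of `Kplus` without the oscillating factor. -/
noncomputable def symbol (j : ℕ) (t ξ : ℝ) : ℂ :=
  if 0 ≤ ((Complex.I * (ξ : ℂ) - 1) ^ (2 * j + 1)).re then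
    Complex.exp (-((t : ℂ) * (Complex.I * (ξ : ℂ) - 1) ^ (2 * j + 1)))
  else 0

theorem Kplus_eq_integral_symbol (j : ℕ) (x : ℝ) {t : ℝ} (ht : 0 ≤ t) :
    Kplus j x t = ∫ ξ : ℝ, Complex.exp (Complex.I * x * ξ) * symbol j t ξ := by
  rw [Kplus, if_pos ht]
  congr 1; ext ξ
  rw [symbol, mul_ite, mul_zero, ← Complex.exp_add, ← sub_eq_add_neg]

theorem measurableSet_re_nonneg (j : ℕ) :
    MeasurableSet {ξ : ℝ | 0 ≤ ((Complex.I * (ξ : ℂ) - 1) ^ (2 * j + 1)).re} :=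
  measurableSet_le measurable_const (by fun_prop)

theorem measurable_symbol (j : ℕ) (t : ℝ) : Measurable (symbol j t) :=
  Measurable.ite (measurableSet_re_nonneg j) (by fun_prop) measurable_const

theorem norm_symbol_le_one (j : ℕ) {t : ℝ} (ht : 0 ≤ t) (ξ : ℝ) : ‖symbol j t ξ‖ ≤ 1 := by
  rw [symbol]
  split_ifs with h
  · rw [Complex.norm_exp, Complex.neg_re, Complex.re_ofReal_mul]
    exact Real.exp_le_one_iff.2 (by have := mul_nonneg ht h; linarith)
  · simp

theorem norm_intervalIntegral_symbol_le {j : ℕ} (hj : 0 < j) {t : ℝ} (ht : 0 < t) (x : ℝ)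
    {c d : ℝ} (hcd : c ≤ d)
    (hF : ∀ ξ ∈ Set.Ioo c d, ((Complex.I * (ξ : ℂ) - 1) ^ (2 * j + 1)).re ≠ 0) :
    ‖∫ ξ in c..d, Complex.exp (Complex.I * x * ξ) * symbol j t ξ‖ ≤
      (2 + 8 * j * Real.pi) * t ^ (-(1 / (2 * (j : ℝ) + 1))) := by
  set r : ℝ → ℝ := fun ξ => ((Complex.I * (ξ : ℂ) - 1) ^ (2 * j + 1)).re with hr
  have hrc : Continuous r := by fun_prop
  set δ := t ^ (-(1 / (2 * (j : ℝ) + 1))) with hδ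
  have hδ0 : 0 < δ := Real.rpow_pos_of_pos ht _
  have hδt : t * δ ^ (2 * j) = δ⁻¹ := by
    refine eq_inv_of_mul_eq_one_left ?_
    rw [mul_assoc, ← pow_succ, hδ, ← Real.rpow_natCast,
      ← Real.rpow_mul ht.le]
    push_cast
    rw [neg_mul, one_div_mul_cancel (by positivity), Real.rpow_neg_one, mul_inv_cancel₀ ht.ne']
  have hsign : (∀ ξ ∈ Set.Ioo c d, 0 < r ξ) ∨ (∀ ξ ∈ Set.Ioo c d, r ξ < 0) := by
    by_contra! hcon
    obtain ⟨⟨u, hu, hu'⟩, v, hv, hv'⟩ := hcon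
    obtain ⟨y, hy, hy'⟩ := isPreconnected_Ioo.intermediate_value hu hv hrc.continuousOn
      (Set.mem_Icc.2 ⟨hu', hv'⟩)
    exact hF y hy hy'
  rcases hcd.eq_or_lt with rfl | hlt
  · rw [intervalIntegral.integral_same, norm_zero]
    positivity
  rcases hsign with hpos | hneg
  · have hnn : ∀ ξ ∈ Set.Icc c d, 0 ≤ r ξ := by
      intro ξ hξ
      rw [← closure_Ioo hlt.ne] at hξ
      exact (isClosed_le continuous_const hrc).closure_subset_iff.2
        (fun y hy => (hpos y hy).le) hξ
    obtain ⟨p, hp, hdeg, hlead⟩ := exists_phase_polynomial hj ht x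
    have hp0 : p.derivative ≠ 0 := fun h => by rw [h] at hdeg; simp at hdeg; omega
    have heq : ∫ ξ in c..d, Complex.exp (Complex.I * x * ξ) * symbol j t ξ =
        ∫ ξ in c..d, Complex.exp (p.eval (ξ : ℂ)) := by
      apply intervalIntegral.integral_congr
      intro ξ hξ
      rw [Set.uIcc_of_le hcd] at hξ
      simp only [symbol]
      rw [if_pos (hnn ξ hξ), ← Complex.exp_add, hp, ← sub_eq_add_neg]
    rw [heq]
    refine (norm_integral_exp_polynomial_le hp0 hδ0 hcd fun ξ hξ => ?_).trans ?_
    · rw [hp, Complex.sub_re, Complex.re_ofReal_mul]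
      have := mul_nonneg ht.le (hnn ξ hξ)
      simp at this ⊢
      exact this
    · rw [hdeg]
      have h1 : (‖p.derivative.leadingCoeff‖ * δ ^ (2 * j))⁻¹ ≤ δ := by
        calc _ ≤ (t * δ ^ (2 * j))⁻¹ := by gcongr
          _ = δ := by rw [hδt, inv_inv]
      calc _ ≤ (2 + 3 * ((2 * j : ℕ) : ℝ) * Real.pi) * δ + ((2 * j : ℕ) : ℝ) * Real.pi * δ := by
            gcongr
        _ = _ := by push_cast; ring
  · have : ∫ ξ in c..d, Complex.exp (Complex.I * x * ξ) * symbol j t ξ = 0 := by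
      rw [intervalIntegral.integral_of_le hcd, integral_Ioc_eq_integral_Ioo]
      refine setIntegral_eq_zero_of_forall_eq_zero fun ξ hξ => ?_
      rw [symbol, if_neg (not_le.2 (hneg ξ hξ)), mul_zero]
    rw [this, norm_zero]
    positivity

theorem exists_norm_Kplus_le {j : ℕ} (hj : 0 < j) :
    ∃ C : ℝ, 1 ≤ C ∧ ∀ t : ℝ, 0 < t → ∀ x, ‖Kplus j x t‖ ≤ C * t ^ (-(1 / (2 * (j : ℝ) + 1))) := by
  set F := (finite_setOf_re_I_mul_sub_one_pow_eq_zero j).toFinset with hF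
  refine ⟨2 ^ F.card * (2 + 8 * j * Real.pi), ?_, fun t ht x => ?_⟩
  · have h1 : (1 : ℝ) ≤ 2 ^ F.card := one_le_pow₀ (by norm_num)
    have h2 : 0 ≤ 8 * (j : ℝ) * Real.pi := by positivity
    nlinarith
  · rw [Kplus_eq_integral_symbol j x ht.le]
    set f : ℝ → ℂ := fun ξ => Complex.exp (Complex.I * x * ξ) * symbol j t ξ with hf
    have hfm : Measurable f := (by fun_prop : Measurable fun ξ : ℝ => Complex.exp (Complex.I * x * ξ)).mul
      (measurable_symbol j t)
    have hf1 : ∀ ξ, ‖f ξ‖ ≤ 1 := fun ξ => by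
      have : ‖Complex.exp (Complex.I * x * ξ)‖ = 1 := by
        rw [Complex.norm_exp]; simp
      rw [hf, norm_mul, this, one_mul]
      exact norm_symbol_le_one j ht.le ξ
    have hfi : ∀ a b, IntervalIntegrable f volume a b := fun a b =>
      (intervalIntegrable_const (c := (1 : ℝ))).mono_fun hfm.aestronglyMeasurable
        (by filter_upwards with ξ using by simpa using hf1 ξ)
    by_cases hfint : Integrable f
    · refine le_of_tendsto (intervalIntegral_tendsto_integral hfint Filter.tendsto_neg_atTop_atBot
        Filter.tendsto_id).norm ?_
      filter_upwards [Filter.eventually_ge_atTop (0 : ℝ)] with R hR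
      rw [mul_assoc]
      refine norm_intervalIntegral_le_of_finset hfi F (-R) R (by linarith) fun c d hcd hcF => ?_
      refine norm_intervalIntegral_symbol_le hj ht x hcd fun ξ hξ h0 => hcF ξ hξ ?_
      simpa [hF] using h0
    · rw [integral_undef hfint, norm_zero]
      positivity

theorem lintegral_Ioc_rpow {p R : ℝ} (hp : 2 < p) (hR : 0 ≤ R) :
    ∫⁻ s in Set.Ioc 0 R, ENNReal.ofReal (s ^ (p - 3)) = ENNReal.ofReal (R ^ (p - 2) / (p - 2)) := by
  have hii : IntervalIntegrable (fun s : ℝ => s ^ (p - 3)) volume 0 R :=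
    intervalIntegral.intervalIntegrable_rpow' (by linarith)
  rw [← ofReal_integral_eq_lintegral_ofReal, ← intervalIntegral.integral_of_le hR,
    integral_rpow (Or.inl (by linarith)), Real.zero_rpow (by linarith), sub_zero,
    show p - 3 + 1 = p - 2 by ring]
  · exact (intervalIntegrable_iff_integrableOn_Ioc_of_le hR).1 hii
  · filter_upwards [ae_restrict_mem measurableSet_Ioc] with s hs using Real.rpow_nonneg hs.1.le _

theorem ofReal_rpow_div_le_lintegral {p u : ℝ} (hp : 2 < p) (hu : 0 ≤ u) :
    ENNReal.ofReal (u ^ p / (4 * (p - 2))) ≤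
      ∫⁻ s in Set.Ioi 0, ENNReal.ofReal (s ^ (p - 3)) * ENNReal.ofReal (max (u - s / 2) 0 ^ 2) := by
  calc ENNReal.ofReal (u ^ p / (4 * (p - 2)))
      = ENNReal.ofReal (u ^ (p - 2) / (p - 2)) * ENNReal.ofReal (u ^ 2 / 4) := by
        rw [← ENNReal.ofReal_mul (by have : 0 < p - 2 := by linarith
                                     positivity)]
        congr 1
        rw [div_mul_div_comm, ← Real.rpow_natCast u 2, ← Real.rpow_add_of_nonneg hu (by linarith)
          (by norm_num), mul_comm 4]
        congr 2; push_cast; ring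
    _ = ∫⁻ s in Set.Ioc 0 u, ENNReal.ofReal (s ^ (p - 3)) * ENNReal.ofReal (u ^ 2 / 4) := by
        rw [lintegral_mul_const' _ _ ENNReal.ofReal_ne_top, lintegral_Ioc_rpow hp hu]
    _ ≤ ∫⁻ s in Set.Ioc 0 u,
          ENNReal.ofReal (s ^ (p - 3)) * ENNReal.ofReal (max (u - s / 2) 0 ^ 2) := by
        refine setLIntegral_mono' measurableSet_Ioc fun s hs => ?_
        gcongr
        have h1 : u / 2 ≤ max (u - s / 2) 0 := le_max_of_le_left (by linarith [hs.2])
        nlinarith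
    _ ≤ _ := lintegral_mono_set Set.Ioc_subset_Ioi_self

theorem lintegral_rpow_mul_indicator_eq {p K v : ℝ} (hp : 2 < p) (hK : 0 < K) (hv : 0 ≤ v) :
    ∫⁻ s in Set.Ioi 0, ENNReal.ofReal (s ^ (p - 3)) *
        (if v ≤ (s / K) ^ (-(p - 1)) then ENNReal.ofReal (v ^ 2) else 0) =
      ENNReal.ofReal (K ^ (p - 2) / (p - 2)) * ENNReal.ofReal (v ^ (p / (p - 1))) := by
  have hp1 : 0 < p - 1 := by linarith
  have hp2 : 0 < p - 2 := by linarith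
  rcases hv.eq_or_lt with rfl | hv
  · rw [Real.zero_rpow (by positivity)]; simp
  set R := K * v ^ (-(1 / (p - 1))) with hR
  have hR0 : 0 < R := by positivity
  have hiff : ∀ s : ℝ, 0 < s → (v ≤ (s / K) ^ (-(p - 1)) ↔ s ≤ R) := fun s hs => by
    have e : v = (R / K) ^ (-(p - 1)) := by
      rw [hR, mul_div_cancel_left₀ _ hK.ne', ← Real.rpow_mul hv.le]
      rw [show -(1 / (p - 1)) * -(p - 1) = 1 by field_simp, Real.rpow_one]
    conv_lhs => rw [e]
    rw [Real.rpow_le_rpow_iff_of_neg (by positivity) (by positivity) (by linarith),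
      div_le_div_iff_of_pos_right hK]
  calc _ = ∫⁻ s in Set.Ioi 0, (Set.Ioc 0 R).indicator
          (fun s => ENNReal.ofReal (s ^ (p - 3)) * ENNReal.ofReal (v ^ 2)) s := by
        refine setLIntegral_congr_fun measurableSet_Ioi fun s hs => ?_
        have hs' : 0 < s := hs
        by_cases h : s ≤ R
        · simp only [if_pos ((hiff s hs').2 h)]
          rw [Set.indicator_of_mem (Set.mem_Ioc.2 ⟨hs', h⟩)]
        · simp only [if_neg (mt (hiff s hs').1 h)]
          rw [Set.indicator_of_notMem (fun h' => h (Set.mem_Ioc.1 h').2), mul_zero]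
    _ = ∫⁻ s in Set.Ioc 0 R, ENNReal.ofReal (s ^ (p - 3)) * ENNReal.ofReal (v ^ 2) := by
        rw [lintegral_indicator measurableSet_Ioc, Measure.restrict_restrict measurableSet_Ioc,
          Set.inter_eq_left.2 Set.Ioc_subset_Ioi_self]
    _ = _ := by
        rw [lintegral_mul_const' _ _ ENNReal.ofReal_ne_top, lintegral_Ioc_rpow hp hR0.le,
          ← ENNReal.ofReal_mul (by positivity), ← ENNReal.ofReal_mul (by positivity)]
        congr 1
        rw [hR, Real.mul_rpow hK.le (by positivity), ← Real.rpow_mul hv.le, ← Real.rpow_natCast v 2,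
          mul_div_right_comm, mul_assoc, ← Real.rpow_add hv]
        congr 2
        push_cast
        field_simp
        ring

/-- A real interpolation estimate for an operator which is bounded
from `L¹` to `L^∞` and on `L²`. -/
theorem lintegral_rpow_le_of_truncation {u v : ℝ → ℝ} (hum : Measurable u) (hvm : Measurable v)
    (hu : ∀ x, 0 ≤ u x) (hv : ∀ x, 0 ≤ v x) {p M N B : ℝ} (hp : 2 < p) (hM : 0 < M) (hN : 0 < N)
    (hB : 0 ≤ B) (hvN : ∫⁻ y, ENNReal.ofReal (v y ^ (p / (p - 1))) ≤ ENNReal.ofReal N)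
    (H : ∀ s l : ℝ, 0 < s → 0 < l →
      ∫⁻ y in {y | l < v y}, ENNReal.ofReal (v y) ≤ ENNReal.ofReal (s / (2 * M)) →
      ∫⁻ x, ENNReal.ofReal (max (u x - s / 2) 0 ^ 2) ≤
        ENNReal.ofReal B * ∫⁻ y, if v y ≤ l then ENNReal.ofReal (v y ^ 2) else 0) :
    ∫⁻ x, ENNReal.ofReal (u x ^ p) ≤ ENNReal.ofReal (4 * B * (2 * M) ^ (p - 2) * N ^ (p - 1)) := by
  have hp1 : 0 < p - 1 := by linarith
  have hp2 : 0 < p - 2 := by linarith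
  set K := 2 * M * N with hK
  have hK0 : 0 < K := by positivity
  have key : ∀ s : ℝ, 0 < s → ∫⁻ x, ENNReal.ofReal (max (u x - s / 2) 0 ^ 2) ≤
      ENNReal.ofReal B *
        ∫⁻ y, if v y ≤ (s / K) ^ (-(p - 1)) then ENNReal.ofReal (v y ^ 2) else 0 := fun s hs => by
    set l := (s / K) ^ (-(p - 1)) with hl
    have hl0 : 0 < l := by positivity
    refine H s l hs hl0 ?_
    have hlp : l ^ (1 - p / (p - 1)) = s / K := by
      rw [hl, ← Real.rpow_mul (by positivity), show -(p - 1) * (1 - p / (p - 1)) = 1 by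
        field_simp; ring, Real.rpow_one]
    calc _ ≤ ∫⁻ y in {y | l < v y}, ENNReal.ofReal (s / K) * ENNReal.ofReal (v y ^ (p / (p - 1))) := by
          refine setLIntegral_mono' (measurableSet_lt measurable_const hvm) fun y hy => ?_
          have hy' : l < v y := hy
          have hvy : 0 < v y := hl0.trans hy'
          rw [← ENNReal.ofReal_mul (by positivity)]
          apply ENNReal.ofReal_le_ofReal
          have h1 : v y ^ (1 - p / (p - 1)) ≤ l ^ (1 - p / (p - 1)) :=
            Real.rpow_le_rpow_of_nonpos hl0 hy'.le (by
              rw [one_sub_div hp1.ne']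
              exact div_nonpos_of_nonpos_of_nonneg (by linarith) hp1.le)
          calc v y = v y ^ (1 - p / (p - 1)) * v y ^ (p / (p - 1)) := by
                rw [← Real.rpow_add hvy]; simp
            _ ≤ _ := by rw [← hlp]; gcongr
      _ ≤ ∫⁻ y, ENNReal.ofReal (s / K) * ENNReal.ofReal (v y ^ (p / (p - 1))) :=
          setLIntegral_le_lintegral _ _
      _ ≤ ENNReal.ofReal (s / K) * ENNReal.ofReal N := by
          rw [lintegral_const_mul' _ _ ENNReal.ofReal_ne_top]
          gcongr
      _ = _ := by
          rw [← ENNReal.ofReal_mul (by positivity)]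
          congr 1
          rw [hK]; field_simp
  have hmain : ∫⁻ x, ENNReal.ofReal (u x ^ p / (4 * (p - 2))) ≤
      ENNReal.ofReal (B * (K ^ (p - 2) / (p - 2)) * N) := by
    calc _ ≤ ∫⁻ x, ∫⁻ s in Set.Ioi 0,
            ENNReal.ofReal (s ^ (p - 3)) * ENNReal.ofReal (max (u x - s / 2) 0 ^ 2) :=
          lintegral_mono fun x => ofReal_rpow_div_le_lintegral hp (hu x)
      _ = ∫⁻ s in Set.Ioi 0, ∫⁻ x,
            ENNReal.ofReal (s ^ (p - 3)) * ENNReal.ofReal (max (u x - s / 2) 0 ^ 2) :=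
          lintegral_lintegral_swap (by fun_prop)
      _ ≤ ∫⁻ s in Set.Ioi 0, ∫⁻ y, ENNReal.ofReal B * (ENNReal.ofReal (s ^ (p - 3)) *
            if v y ≤ (s / K) ^ (-(p - 1)) then ENNReal.ofReal (v y ^ 2) else 0) := by
          refine setLIntegral_mono' measurableSet_Ioi fun s hs => ?_
          rw [lintegral_const_mul' _ _ ENNReal.ofReal_ne_top,
            lintegral_const_mul' _ _ ENNReal.ofReal_ne_top,
            lintegral_const_mul' _ _ ENNReal.ofReal_ne_top, mul_left_comm]
          gcongr
          exact key s hs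
      _ = ∫⁻ y, ∫⁻ s in Set.Ioi 0, ENNReal.ofReal B * (ENNReal.ofReal (s ^ (p - 3)) *
            if v y ≤ (s / K) ^ (-(p - 1)) then ENNReal.ofReal (v y ^ 2) else 0) := by
          refine lintegral_lintegral_swap (Measurable.aemeasurable ?_)
          refine Measurable.const_mul (Measurable.mul (by fun_prop) ?_) _
          exact Measurable.ite (measurableSet_le (by fun_prop) (by fun_prop)) (by fun_prop)
            measurable_const
      _ = ∫⁻ y, ENNReal.ofReal (B * (K ^ (p - 2) / (p - 2))) *
            ENNReal.ofReal (v y ^ (p / (p - 1))) := by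
          congr 1; ext y
          rw [lintegral_const_mul' _ _ ENNReal.ofReal_ne_top,
            lintegral_rpow_mul_indicator_eq hp hK0 (hv y), ← mul_assoc, ENNReal.ofReal_mul hB]
      _ ≤ _ := by
          rw [lintegral_const_mul' _ _ ENNReal.ofReal_ne_top,
            ENNReal.ofReal_mul (q := N) (by positivity)]
          gcongr
  calc ∫⁻ x, ENNReal.ofReal (u x ^ p)
      = ∫⁻ x, ENNReal.ofReal (4 * (p - 2)) * ENNReal.ofReal (u x ^ p / (4 * (p - 2))) := by
        congr 1; ext x
        rw [← ENNReal.ofReal_mul (by positivity), mul_div_cancel₀ _ (by positivity)]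
    _ ≤ ENNReal.ofReal (4 * (p - 2)) * ENNReal.ofReal (B * (K ^ (p - 2) / (p - 2)) * N) := by
        rw [lintegral_const_mul' _ _ ENNReal.ofReal_ne_top]
        gcongr
    _ = _ := by
        rw [← ENNReal.ofReal_mul (by positivity)]
        congr 1
        rw [hK, Real.mul_rpow (by positivity) hN.le, show p - 1 = p - 2 + 1 by ring,
          Real.rpow_add_one hN.ne']
        field_simp

theorem lintegral_ofReal_norm_rpow {f : ℝ → ℂ} {p : ℝ} (hp : 0 < p) :
    ∫⁻ x, ENNReal.ofReal (‖f x‖ ^ p) = eLpNorm f (ENNReal.ofReal p) volume ^ p := by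
  rw [eLpNorm_eq_lintegral_rpow_enorm_toReal (by simpa using hp) ENNReal.ofReal_ne_top,
    ENNReal.toReal_ofReal hp.le, ← ENNReal.rpow_mul, one_div_mul_cancel hp.ne', ENNReal.rpow_one]
  congr 1; ext x
  rw [← ofReal_norm, ENNReal.ofReal_rpow_of_nonneg (norm_nonneg _) hp.le]

theorem lintegral_ofReal_norm_sq {f : ℝ → ℂ} :
    ∫⁻ x, ENNReal.ofReal (‖f x‖ ^ 2) = eLpNorm f 2 volume ^ 2 := by
  have h := lintegral_ofReal_norm_rpow (f := f) (p := 2) two_pos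
  rw [ENNReal.ofReal_ofNat] at h
  simpa only [← Real.rpow_natCast, ← ENNReal.rpow_natCast, Nat.cast_ofNat] using h

theorem continuous_fourierInv_of_integrable {A : ℝ → ℂ} (hA : Integrable A) :
    Continuous (𝓕⁻ A) := by
  have h : 𝓕⁻ A = 𝓕 A ∘ Neg.neg := by
    ext x; exact Real.fourierInv_eq_fourier_neg A x
  rw [h]
  exact (VectorFourier.fourierIntegral_continuous (L := innerₗ ℝ) Real.continuous_fourierChar
    continuous_inner hA).comp continuous_neg

theorem lintegral_truncated_convolution_sq_le {A : ℝ → ℂ} {C M : ℝ} (hA : Integrable A)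
    (hC : ∀ η, ‖A η‖ ≤ C) (hC0 : 0 ≤ C) (hM : 0 < M) (hAM : ∀ x, ‖𝓕⁻ A x‖ ≤ M) {g : ℝ → ℂ}
    (hgm : Measurable g) (hg : Integrable g) (hg2 : MemLp g 2) {s l : ℝ} (hs : 0 < s)
    (hl : ∫⁻ y in {y | l < ‖g y‖}, ENNReal.ofReal ‖g y‖ ≤ ENNReal.ofReal (s / (2 * M))) :
    ∫⁻ x, ENNReal.ofReal (max (‖∫ y, 𝓕⁻ A (x - y) * g y‖ - s / 2) 0 ^ 2) ≤
      ENNReal.ofReal (C ^ 2) * ∫⁻ y, if ‖g y‖ ≤ l then ENNReal.ofReal (‖g y‖ ^ 2) else 0 := by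
  set S : Set ℝ := {y | l < ‖g y‖} with hS
  have hSm : MeasurableSet S := measurableSet_lt measurable_const hgm.norm
  set g₁ := S.indicator g with hg₁
  set g₂ := Sᶜ.indicator g with hg₂
  have hkc := continuous_fourierInv_of_integrable hA
  have hint : ∀ (φ : ℝ → ℂ) (x : ℝ), Integrable φ → Integrable fun y => 𝓕⁻ A (x - y) * φ y :=
    fun φ x hφ => hφ.bdd_mul (c := M)
      (hkc.comp (continuous_const.sub continuous_id)).aestronglyMeasurable
      (by filter_upwards with y using hAM _)
  have hi₁ : Integrable g₁ := hg.indicator hSm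
  have hi₂ : Integrable g₂ := hg.indicator hSm.compl
  have hlarge : ∀ x, ‖∫ y, 𝓕⁻ A (x - y) * g₁ y‖ ≤ s / 2 := fun x => by
    have h1 : ∫ y, ‖g₁ y‖ ≤ s / (2 * M) := by
      rw [integral_norm_eq_lintegral_enorm hi₁.aestronglyMeasurable]
      refine ENNReal.toReal_le_of_le_ofReal (by positivity) (le_trans (le_of_eq ?_) hl)
      rw [← lintegral_indicator hSm]
      congr 1; ext y
      by_cases hy : y ∈ S <;> simp [hg₁, hy, ← ofReal_norm]
    calc _ ≤ ∫ y, M * ‖g₁ y‖ := by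
          refine norm_integral_le_of_norm_le (hi₁.norm.const_mul M) ?_
          filter_upwards with y
          rw [norm_mul]
          gcongr
          exact hAM _
      _ ≤ M * (s / (2 * M)) := by rw [integral_const_mul]; gcongr
      _ = s / 2 := by field_simp
  have hsmall : ∀ x, max (‖∫ y, 𝓕⁻ A (x - y) * g y‖ - s / 2) 0 ≤
      ‖∫ y, 𝓕⁻ A (x - y) * g₂ y‖ := fun x => by
    refine max_le ?_ (norm_nonneg _)
    have hsum : ∫ y, 𝓕⁻ A (x - y) * g y =
        (∫ y, 𝓕⁻ A (x - y) * g₁ y) + ∫ y, 𝓕⁻ A (x - y) * g₂ y := by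
      rw [← integral_add (hint g₁ x hi₁) (hint g₂ x hi₂)]
      congr 1; ext y
      rw [← mul_add, hg₁, hg₂, Set.indicator_self_add_compl_apply]
    rw [hsum]
    linarith [norm_add_le (∫ y, 𝓕⁻ A (x - y) * g₁ y) (∫ y, 𝓕⁻ A (x - y) * g₂ y), hlarge x]
  calc _ ≤ ∫⁻ x, ENNReal.ofReal (‖∫ y, 𝓕⁻ A (x - y) * g₂ y‖ ^ 2) := by
        refine lintegral_mono fun x => ENNReal.ofReal_le_ofReal ?_
        exact pow_le_pow_left₀ (le_max_right _ _) (hsmall x) 2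
    _ ≤ (ENNReal.ofReal C * eLpNorm g₂ 2 volume) ^ 2 := by
        rw [lintegral_ofReal_norm_sq]
        gcongr
        exact eLpNorm_two_convolution_fourierInv_le hA hC hi₂ (hg2.indicator hSm.compl)
    _ = _ := by
        rw [mul_pow, ← ENNReal.ofReal_pow hC0, ← lintegral_ofReal_norm_sq]
        congr 2; ext y
        by_cases hy : y ∈ S
        · have : ¬ ‖g y‖ ≤ l := not_le.2 hy
          simp [hg₂, hy, this]
        · have h : ‖g y‖ ≤ l := not_lt.1 hy
          simp [hg₂, hy, h]

/-- Interpolation between the `L¹ → L^∞` and `L² → L²` bounds of a convolution operator. -/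
theorem eLpNorm_convolution_fourierInv_le {A : ℝ → ℂ} {C M : ℝ} (hA : Integrable A)
    (hC : ∀ η, ‖A η‖ ≤ C) (hC1 : 1 ≤ C) (hM : 0 < M) (hAM : ∀ x, ‖𝓕⁻ A x‖ ≤ M) {g : ℝ → ℂ}
    (hgm : Measurable g) (hg : Integrable g) (hg2 : MemLp g 2) {p : ℝ} (hp : 2 < p) :
    eLpNorm (fun x => ∫ y, 𝓕⁻ A (x - y) * g y) (ENNReal.ofReal p) volume ≤
      ENNReal.ofReal (4 * C ^ 2 * (2 * M) ^ (1 - 2 / p)) *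
        eLpNorm g (ENNReal.ofReal (p / (p - 1))) volume := by
  have hp0 : 0 < p := by linarith
  have hp1 : 0 < p - 1 := by linarith
  set r := p / (p - 1) with hr
  have hr0 : 0 < r := by positivity
  have hc0 : 0 < 4 * C ^ 2 * (2 * M) ^ (1 - 2 / p) := by positivity
  by_cases h0 : eLpNorm g (ENNReal.ofReal r) volume = 0
  · have hae := (eLpNorm_eq_zero_iff hg.aestronglyMeasurable (by simpa using hr0)).1 h0
    have : (fun x => ∫ y, 𝓕⁻ A (x - y) * g y) = 0 := by
      ext x
      refine integral_eq_zero_of_ae ?_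
      filter_upwards [hae] with y hy
      simp [hy]
    rw [this]; simp
  by_cases htop : eLpNorm g (ENNReal.ofReal r) volume = ⊤
  · rw [htop, ENNReal.mul_top (by simpa using hc0)]; exact le_top
  set G := (eLpNorm g (ENNReal.ofReal r) volume).toReal with hG
  have hG0 : 0 < G := ENNReal.toReal_pos h0 htop
  have hGeq : eLpNorm g (ENNReal.ofReal r) volume = ENNReal.ofReal G :=
    (ENNReal.ofReal_toReal htop).symm
  have hcont : Continuous fun x => ∫ y, 𝓕⁻ A (x - y) * g y := by
    simp_rw [integral_fourierInv_sub_mul hA hg]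
    refine continuous_fourierInv_of_integrable (hA.mul_bdd (c := ∫ v, ‖g v‖) ?_ ?_)
    · exact (VectorFourier.fourierIntegral_continuous (L := innerₗ ℝ) Real.continuous_fourierChar
        continuous_inner hg).aestronglyMeasurable
    · filter_upwards with η
      exact VectorFourier.norm_fourierIntegral_le_integral_norm _ _ _ _ _
  have h := lintegral_rpow_le_of_truncation (u := fun x => ‖∫ y, 𝓕⁻ A (x - y) * g y‖)
    (v := fun y => ‖g y‖) hcont.norm.measurable hgm.norm (fun _ => norm_nonneg _)
    (fun _ => norm_nonneg _) (N := G ^ r) (B := C ^ 2) hp hM (by positivity) (by positivity)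
    (by rw [lintegral_ofReal_norm_rpow hr0, hGeq, ENNReal.ofReal_rpow_of_pos hG0])
    (fun s l hs _ hl => lintegral_truncated_convolution_sq_le hA hC (by linarith) hM hAM hgm hg hg2
      hs hl)
  rw [lintegral_ofReal_norm_rpow hp0] at h
  rw [hGeq, ← ENNReal.ofReal_mul hc0.le]
  rw [← ENNReal.rpow_le_rpow_iff hp0, ENNReal.ofReal_rpow_of_pos (by positivity)]
  refine h.trans (ENNReal.ofReal_le_ofReal ?_)
  rw [Real.mul_rpow hc0.le hG0.le,
    Real.mul_rpow (x := 4 * C ^ 2) (y := (2 * M) ^ (1 - 2 / p)) (by positivity) (by positivity),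
    ← Real.rpow_mul (x := 2 * M) (by positivity) (1 - 2 / p) p, ← Real.rpow_mul hG0.le r (p - 1),
    show (1 - 2 / p) * p = p - 2 by field_simp, show r * (p - 1) = p by rw [hr]; field_simp]
  gcongr
  exact Real.self_le_rpow_of_one_le (by nlinarith) (by linarith)

theorem Kplus_eq_fourierInv (j : ℕ) (x : ℝ) {t : ℝ} (ht : 0 ≤ t) :
    Kplus j x t = 𝓕⁻ (fun η : ℝ => (2 * Real.pi : ℂ) * symbol j t (2 * Real.pi * η)) x := by
  rw [Kplus_eq_integral_symbol j x ht, Real.fourierInv_eq']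
  have h := Measure.integral_comp_mul_left
    (fun ξ : ℝ => Complex.exp (Complex.I * x * ξ) * symbol j t ξ) (2 * Real.pi)
  rw [abs_of_pos (by positivity), eq_inv_smul_iff₀ (by positivity), ← integral_smul] at h
  rw [← h]
  congr 1; ext η
  simp only [smul_eq_mul, Complex.real_smul]
  push_cast
  rw [mul_left_comm]
  congr 2
  simp
  ring

theorem Kplus_eq_zero_of_not_integrable (j : ℕ) (x : ℝ) {t : ℝ} (ht : 0 ≤ t)
    (h : ¬ Integrable (symbol j t)) : Kplus j x t = 0 := by
  rw [Kplus_eq_integral_symbol j x ht]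
  refine integral_undef fun hi => h ?_
  refine hi.mono (measurable_symbol j t).aestronglyMeasurable ?_
  filter_upwards with ξ
  rw [norm_mul, Complex.norm_exp]
  simp

theorem exists_eLpNorm_Kplus_convolution_le {j : ℕ} (hj : 0 < j) :
    ∃ c : ℝ, 0 < c ∧ ∀ p : ℝ, 2 ≤ p → ∀ t : ℝ, 0 < t → ∀ g : SchwartzMap ℝ ℂ,
      eLpNorm (fun x : ℝ => ∫ y : ℝ, Kplus j (x - y) t * g y) (ENNReal.ofReal p) volume ≤
        ENNReal.ofReal (c * t ^ (-(1 / (2 * (j : ℝ) + 1)) * (1 - 2 / p))) *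
          eLpNorm (fun y => g y) (ENNReal.ofReal (p / (p - 1))) volume := by
  obtain ⟨C, hC1, hC⟩ := exists_norm_Kplus_le hj
  have hpi : 1 ≤ 2 * Real.pi := by linarith [Real.pi_gt_three]
  refine ⟨4 * (2 * Real.pi) ^ 2 * (2 * C), by positivity, fun p hp t ht g => ?_⟩
  by_cases hi : Integrable (symbol j t)
  swap
  · simp [Kplus_eq_zero_of_not_integrable j _ ht.le hi]
  simp_rw [Kplus_eq_fourierInv j _ ht.le] at hC ⊢
  set A : ℝ → ℂ := fun η : ℝ => (2 * Real.pi : ℂ) * symbol j t (2 * Real.pi * η) with hA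
  have hAi : Integrable A := (hi.comp_mul_left' (by positivity)).const_mul _
  have hAb : ∀ η, ‖A η‖ ≤ 2 * Real.pi := fun η => by
    have h2 : ‖(2 * Real.pi : ℂ)‖ = 2 * Real.pi := by
      simp [abs_of_pos Real.pi_pos]
    rw [hA, norm_mul, h2]
    exact mul_le_of_le_one_right (by positivity) (norm_symbol_le_one j ht.le _)
  have hg2 : MemLp (fun y => g y) 2 volume := g.memLp 2 volume
  rcases hp.eq_or_lt with rfl | hp
  · have h := eLpNorm_two_convolution_fourierInv_le hAi hAb g.integrable hg2
    rw [show (2 : ℝ) / (2 - 1) = 2 by norm_num, ENNReal.ofReal_ofNat]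
    refine h.trans ?_
    gcongr ENNReal.ofReal ?_ * _
    rw [show (1 : ℝ) - 2 / 2 = 0 by norm_num, mul_zero, Real.rpow_zero, mul_one]
    nlinarith
  · set M := C * t ^ (-(1 / (2 * (j : ℝ) + 1))) with hM
    have hM0 : 0 < M := by positivity
    refine (eLpNorm_convolution_fourierInv_le hAi hAb hpi hM0
      (fun x => by simpa only [Kplus_eq_fourierInv j _ ht.le] using hC t ht x)
      g.continuous.measurable g.integrable hg2 hp).trans ?_
    gcongr ENNReal.ofReal ?_ * _
    rw [hM, ← mul_assoc 2 C, Real.mul_rpow (by positivity) (by positivity), ← Real.rpow_mul ht.le,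
      ← mul_assoc]
    gcongr
    have hp0 : 0 < p := by linarith
    exact Real.rpow_le_self_of_one_le (by linarith) (by
      have : 0 < 2 / p := by positivity
      linarith)

theorem stmt17 (j : ℕ) (hj : 0 < j) : ∃ c : ℝ, 0 < c ∧
    ∀ p p' : ℝ, 2 ≤ p → 1 / p + 1 / p' = 1 → ∀ t : ℝ, t ≠ 0 → ∀ g : SchwartzMap ℝ ℂ,
      eLpNorm (fun x : ℝ => ∫ y : ℝ, Kplus j (x - y) t * g y) (ENNReal.ofReal p) volume ≤
        ENNReal.ofReal (c * |t| ^ (-(1 / (2 * (j : ℝ) + 1)) * (1 / p' - 1 / p))) *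
          eLpNorm (fun y => g y) (ENNReal.ofReal p') volume := by
  obtain ⟨c, hc, h⟩ := exists_eLpNorm_Kplus_convolution_le hj
  refine ⟨c, hc, fun p p' hp hpp t ht g => ?_⟩
  rcases ht.lt_or_gt with hneg | hpos
  · simp [Kplus, not_le.2 hneg]
  have hp0 : 0 < p := by linarith
  have hp' : p' = p / (p - 1) := by
    have h1 : 1 / p' = (p - 1) / p := by rw [sub_div, div_self hp0.ne']; linarith
    rw [← one_div_one_div p', h1, one_div_div]
  rw [abs_of_pos hpos, show 1 / p' - 1 / p = 1 - 2 / p by linear_combination hpp, hp']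
  exact h p hp t hpos g
end

section
/- Let u ∈ C([0,1]: H⁴(ℝ)) ∩ C¹([0,1]: H¹(ℝ)) be a real solution of ∂_t u + ∂_x³ u + u^k ∂_x u = 0 on ℝ × [0,1] with supp u(·,0) ⊆ (−∞, b]. Then for every β > 0 there is a constant c_{b,β} such that |u(x,t)| + |∂_x u(x,t)| + |∂_x² u(x,t)| ≤ c_{b,β} e^{−βx} for all x > 0, t ∈ [0,1]. -/
open MeasureTheory

noncomputable def pdx (f : ℝ × ℝ → ℝ) : ℝ × ℝ → ℝ := fun p => deriv (fun x => f (x, p.2)) p.1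
noncomputable def pdt (f : ℝ × ℝ → ℝ) : ℝ × ℝ → ℝ := fun p => deriv (fun t => f (p.1, t)) p.2

open Set Filter Topology

lemma hasDerivAt_pdx {f : ℝ × ℝ → ℝ} (hf : ContDiff ℝ (⊤ : ℕ∞) f) (x t : ℝ) :
    HasDerivAt (fun y => f (y, t)) (pdx f (x, t)) x := by
  have h : ContDiff ℝ (⊤ : ℕ∞) (fun y : ℝ => f (y, t)) := by fun_prop
  exact ((h.differentiable (by simp)) x).hasDerivAt

lemma hasDerivAt_pdt {f : ℝ × ℝ → ℝ} (hf : ContDiff ℝ (⊤ : ℕ∞) f) (x t : ℝ) :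
    HasDerivAt (fun s => f (x, s)) (pdt f (x, t)) t := by
  have h : ContDiff ℝ (⊤ : ℕ∞) (fun s : ℝ => f (x, s)) := by fun_prop
  exact ((h.differentiable (by simp)) t).hasDerivAt

lemma contDiff_pdx {f : ℝ × ℝ → ℝ} (hf : ContDiff ℝ (⊤ : ℕ∞) f) :
    ContDiff ℝ (⊤ : ℕ∞) (pdx f) := by
  have h : pdx f = fun p => fderiv ℝ f p (1, 0) := by
    funext p
    have h1 := (hf.differentiable (by simp) p).hasFDerivAt
    have h2 : HasDerivAt (fun y : ℝ => (y, p.2)) (1, 0) p.1 :=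
      (hasDerivAt_id p.1).prodMk (hasDerivAt_const p.1 p.2)
    exact (hasDerivAt_pdx hf p.1 p.2).unique (h1.comp_hasDerivAt p.1 h2)
  rw [h]
  exact (hf.fderiv_right (by simp)).clm_apply contDiff_const

lemma continuous_pdt {f : ℝ × ℝ → ℝ} (hf : ContDiff ℝ (⊤ : ℕ∞) f) :
    Continuous (pdt f) := by
  have h : pdt f = fun p => fderiv ℝ f p (0, 1) := by
    funext p
    have h1 := (hf.differentiable (by simp) p).hasFDerivAt
    have h2 : HasDerivAt (fun s : ℝ => (p.1, s)) (0, 1) p.2 :=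
      (hasDerivAt_const p.2 p.1).prodMk (hasDerivAt_id p.2)
    exact (hasDerivAt_pdt hf p.1 p.2).unique (h1.comp_hasDerivAt p.2 h2)
  rw [h]
  exact (hf.continuous_fderiv (by simp)).clm_apply continuous_const

lemma contDiff_pdx_iterate {f : ℝ × ℝ → ℝ} (hf : ContDiff ℝ (⊤ : ℕ∞) f) (n : ℕ) :
    ContDiff ℝ (⊤ : ℕ∞) (pdx^[n] f) := by
  induction n with
  | zero => exact hf
  | succ n ih => rw [Function.iterate_succ_apply']; exact contDiff_pdx ih

lemma iteratedDeriv_slice (f : ℝ × ℝ → ℝ) (n : ℕ) (t : ℝ) :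
    iteratedDeriv n (fun y => f (y, t)) = fun x => (pdx^[n] f) (x, t) := by
  induction n with
  | zero => simp
  | succ n ih => rw [iteratedDeriv_succ, ih, Function.iterate_succ_apply']; rfl

lemma integrable_sq_and_integral_le {f : ℝ → ℝ} (hf : Continuous f) {A : ℝ} (hA : 0 ≤ A)
    (h : eLpNorm f 2 volume ≤ ENNReal.ofReal A) :
    Integrable (fun x => f x ^ 2) ∧ ∫ x, f x ^ 2 ≤ A ^ 2 := by
  have hm : MemLp f 2 volume := ⟨hf.aestronglyMeasurable, h.trans_lt ENNReal.ofReal_lt_top⟩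
  refine ⟨hm.integrable_sq, ?_⟩
  rw [hm.eLpNorm_eq_integral_rpow_norm two_ne_zero ENNReal.ofNat_ne_top,
    ENNReal.ofReal_le_ofReal_iff hA] at h
  simp only [ENNReal.toReal_ofNat, Real.rpow_ofNat, Real.norm_eq_abs, sq_abs] at h
  rw [← one_div, ← Real.sqrt_eq_rpow] at h
  exact (Real.sqrt_le_left hA).1 h

lemma tendsto_zero_of_sq {f : ℝ → ℝ} {l : Filter ℝ} (h : Tendsto (fun x => f x ^ 2) l (𝓝 0)) :
    Tendsto f l (𝓝 0) := by
  have := h.sqrt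
  simp only [Real.sqrt_sq_eq_abs, Real.sqrt_zero] at this
  exact (tendsto_zero_iff_abs_tendsto_zero f).2 this

section Sobolev

variable {f f' : ℝ → ℝ} (hd : ∀ x, HasDerivAt f (f' x) x) (hc : Continuous f')
  (h0 : Integrable fun x => f x ^ 2) (h1 : Integrable fun x => f' x ^ 2)

include hd hc h0 h1

lemma integrable_two_mul_mul_deriv : Integrable fun x => 2 * f x * f' x := by
  have hf : Continuous f := continuous_iff_continuousAt.2 fun x => (hd x).continuousAt
  refine (h0.add h1).mono' (by fun_prop) (Eventually.of_forall fun x => ?_)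
  rw [Real.norm_eq_abs, Pi.add_apply, abs_le]
  constructor <;> nlinarith [sq_nonneg (f x - f' x), sq_nonneg (f x + f' x)]

omit hc h0 h1 in
lemma hasDerivAt_sq (x : ℝ) : HasDerivAt (fun x => f x ^ 2) (2 * f x * f' x) x := by
  simpa using (hd x).fun_pow 2

lemma tendsto_atTop_zero_of_sq_integrable : Tendsto f atTop (𝓝 0) :=
  tendsto_zero_of_sq <| tendsto_zero_of_hasDerivAt_of_integrableOn_Ioi (a := 0)
    (fun x _ => hasDerivAt_sq hd x)
    (integrable_two_mul_mul_deriv hd hc h0 h1).integrableOn h0.integrableOn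

lemma tendsto_atBot_zero_of_sq_integrable : Tendsto f atBot (𝓝 0) :=
  tendsto_zero_of_sq <| tendsto_zero_of_hasDerivAt_of_integrableOn_Iic (a := 0)
    (fun x _ => hasDerivAt_sq hd x)
    (integrable_two_mul_mul_deriv hd hc h0 h1).integrableOn h0.integrableOn

lemma sq_le_integral_sq_add (a : ℝ) : f a ^ 2 ≤ (∫ x, f x ^ 2) + ∫ x, f' x ^ 2 := by
  have hi := integrable_two_mul_mul_deriv hd hc h0 h1
  have ht := (tendsto_atTop_zero_of_sq_integrable hd hc h0 h1).pow 2
  have h := integral_Ioi_of_hasDerivAt_of_tendsto' (a := a)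
    (fun x _ => hasDerivAt_sq hd x) hi.integrableOn ht
  have h2 : f a ^ 2 = ∫ x in Ioi a, -(2 * f x * f' x) := by
    rw [integral_neg, h]; ring
  rw [h2, ← integral_add h0 h1]
  refine (setIntegral_mono hi.neg.integrableOn (h0.add h1).integrableOn fun x => ?_).trans
    (setIntegral_le_integral (h0.add h1) (Eventually.of_forall fun x => ?_))
  · simp only [Pi.add_apply, Pi.neg_apply]
    nlinarith [sq_nonneg (f x + f' x)]
  · simp only [Pi.add_apply, Pi.zero_apply]
    positivity

end Sobolev

/-- A Landau-type interpolation inequality: exponential decay passes to the derivative. -/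
lemma abs_deriv_le_of_decay {f f' f'' : ℝ → ℝ} {a M β : ℝ}
    (h1 : ∀ x, HasDerivAt f (f' x) x) (h2 : ∀ x, HasDerivAt f' (f'' x) x)
    (hM : ∀ x, |f'' x| ≤ M) (hβ : 0 ≤ β)
    (hf : ∀ x, |f x| ≤ a * Real.exp (-(2 * β) * x)) (x : ℝ) :
    |f' x| ≤ (2 * a + M) * Real.exp (-β * x) := by
  set h := Real.exp (-β * x) with hh
  have hpos : 0 < h := Real.exp_pos _
  have hsq : Real.exp (-(2 * β) * x) = h * h := by
    rw [hh, ← Real.exp_add]; ring_nf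
  have ha : 0 ≤ a := by
    by_contra! hneg
    exact absurd ((abs_nonneg _).trans (hf x)) (not_le.2 (mul_neg_of_neg_of_pos hneg (Real.exp_pos _)))
  have hx : |f x| ≤ a * (h * h) := hsq ▸ hf x
  have hxh : |f (x + h)| ≤ a * (h * h) := by
    refine (hf _).trans ?_
    rw [← hsq]
    gcongr ?_ * Real.exp ?_
    nlinarith
  obtain ⟨ξ, hξ, e⟩ := exists_hasDerivAt_eq_slope f f' (show x < x + h by linarith)
    (fun y _ => (h1 y).continuousAt.continuousWithinAt) (fun y _ => h1 y)
  obtain ⟨η, -, e'⟩ := exists_hasDerivAt_eq_slope f' f'' hξ.1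
    (fun y _ => (h2 y).continuousAt.continuousWithinAt) (fun y _ => h2 y)
  have hξx : 0 < ξ - x := by linarith [hξ.1]
  rw [add_sub_cancel_left, eq_div_iff hpos.ne'] at e
  rw [eq_div_iff hξx.ne'] at e'
  have hξv : |f' ξ| ≤ 2 * a * h := by
    refine le_of_mul_le_mul_right ?_ hpos
    rw [← abs_of_pos hpos, ← abs_mul, abs_of_pos hpos, e]
    calc |f (x + h) - f x| ≤ |f (x + h)| + |f x| := abs_sub _ _
      _ ≤ 2 * a * h * h := by linarith
  have hdiff : |f' ξ - f' x| ≤ M * h := by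
    rw [← e', abs_mul, abs_of_pos hξx]
    have := hM η
    have : ξ - x ≤ h := by linarith [hξ.2]
    gcongr
    exact (abs_nonneg _).trans (hM η)
  rw [abs_le] at *
  constructor <;> nlinarith

lemma gronwall_of_deriv_le {E E' δ : ℝ → ℝ} {C : ℝ} (hC : 0 ≤ C)
    (hE : ∀ t, HasDerivAt E (E' t) t) (hδ : Continuous δ) (hδ0 : ∀ t, 0 ≤ δ t) (hE0 : 0 ≤ E 0)
    (h : ∀ t ∈ Icc (0 : ℝ) 1, E' t ≤ δ t + C * E t) :
    ∀ t ∈ Icc (0 : ℝ) 1, E t ≤ Real.exp C * (E 0 + ∫ s in (0 : ℝ)..1, δ s) := by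
  intro t ht
  have hd : ∀ s, HasDerivAt (fun s => Real.exp (-C * s) * E s - ∫ r in (0 : ℝ)..s, δ r)
      (Real.exp (-C * s) * (-C * 1) * E s + Real.exp (-C * s) * E' s - δ s) s := fun s =>
    ((((hasDerivAt_id s).const_mul (-C)).exp).mul (hE s)).sub
      (intervalIntegral.integral_hasDerivAt_right (hδ.intervalIntegrable _ _)
        (hδ.stronglyMeasurableAtFilter _ _) hδ.continuousAt)
  have hanti : AntitoneOn (fun s => Real.exp (-C * s) * E s - ∫ r in (0 : ℝ)..s, δ r)
      (Icc 0 1) := by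
    refine antitoneOn_of_deriv_nonpos (convex_Icc 0 1)
      (fun s _ => (hd s).continuousAt.continuousWithinAt)
      (fun s _ => (hd s).differentiableAt.differentiableWithinAt) fun s hs => ?_
    rw [(hd s).deriv]
    have hs' := interior_subset hs
    have h1 : Real.exp (-C * s) ≤ 1 := Real.exp_le_one_iff.2 (by nlinarith [hs'.1])
    have h2 := mul_le_mul_of_nonneg_left (h s hs') (Real.exp_pos (-C * s)).le
    have h3 := mul_le_mul_of_nonneg_right h1 (hδ0 s)
    nlinarith
  have h1 := hanti (left_mem_Icc.2 zero_le_one) ht ht.1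
  simp only [mul_zero, Real.exp_zero, one_mul, intervalIntegral.integral_same, sub_zero] at h1
  have h2 : ∫ s in (0 : ℝ)..t, δ s ≤ ∫ s in (0 : ℝ)..1, δ s :=
    intervalIntegral.integral_mono_interval le_rfl ht.1 ht.2 (Eventually.of_forall hδ0)
      (hδ.intervalIntegrable _ _)
  have h3 : 0 ≤ ∫ s in (0 : ℝ)..1, δ s :=
    intervalIntegral.integral_nonneg zero_le_one fun s _ => hδ0 s
  have h4 : E t = Real.exp (C * t) * (Real.exp (-C * t) * E t) := by
    rw [← mul_assoc, ← Real.exp_add]; simp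
  rw [h4]
  have h5 : Real.exp (C * t) ≤ Real.exp C := Real.exp_le_exp.2 (by nlinarith [ht.2])
  calc _ ≤ Real.exp (C * t) * (E 0 + ∫ s in (0 : ℝ)..1, δ s) := by gcongr; linarith
    _ ≤ _ := by gcongr

lemma hasDerivAt_intervalIntegral_of_continuous {g g' : ℝ → ℝ → ℝ}
    (hg : Continuous fun p : ℝ × ℝ => g p.1 p.2) (hg' : Continuous fun p : ℝ × ℝ => g' p.1 p.2)
    (hd : ∀ x t, HasDerivAt (fun s => g x s) (g' x t) t) (a b t : ℝ) :
    HasDerivAt (fun s => ∫ x in a..b, g x s) (∫ x in a..b, g' x t) t := by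
  obtain ⟨C, hC⟩ := ((isCompact_uIcc (a := a) (b := b)).prod
    (isCompact_Icc (a := t - 1) (b := t + 1))).exists_bound_of_continuousOn hg'.continuousOn
  have hslice : ∀ {h : ℝ → ℝ → ℝ}, (Continuous fun p : ℝ × ℝ => h p.1 p.2) →
      ∀ s, Continuous fun x => h x s := fun hh s =>
    hh.comp (continuous_id.prodMk continuous_const)
  refine (intervalIntegral.hasDerivAt_integral_of_dominated_loc_of_deriv_le
    (F := fun s x => g x s) (F' := fun s x => g' x s) (bound := fun _ => C)
    (Icc_mem_nhds (show t - 1 < t by linarith) (show t < t + 1 by linarith))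
    (Eventually.of_forall fun s => (hslice hg s).aestronglyMeasurable)
    ((hslice hg t).intervalIntegrable _ _) (hslice hg' t).aestronglyMeasurable
    (Eventually.of_forall fun x hx s hs => hC (x, s) ⟨uIoc_subset_uIcc hx, hs⟩)
    intervalIntegrable_const (Eventually.of_forall fun x _ s _ => hd x s)).2

/-- A bounded increasing weight with its first three derivatives, comparable to `exp (β x)`. -/
structure IsKatoWeight (β P : ℝ) (φ φ₁ φ₂ φ₃ : ℝ → ℝ) : Prop where
  deriv₀ : ∀ x, HasDerivAt φ (φ₁ x) x
  deriv₁ : ∀ x, HasDerivAt φ₁ (φ₂ x) x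
  deriv₂ : ∀ x, HasDerivAt φ₂ (φ₃ x) x
  cont₃ : Continuous φ₃
  nonneg : ∀ x, 0 ≤ φ x
  le_bound : ∀ x, φ x ≤ P
  le_exp : ∀ x, φ x ≤ Real.exp (β * x)
  deriv_nonneg : ∀ x, 0 ≤ φ₁ x
  deriv_le : ∀ x, φ₁ x ≤ β * φ x
  abs_deriv₁_le : ∀ x, |φ₂ x| ≤ β ^ 2 * φ x
  deriv₂_le : ∀ x, φ₃ x ≤ β ^ 3 * φ x

lemma exists_isKatoWeight {β ε : ℝ} (hβ : 0 < β) (hε : 0 < ε) :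
    ∃ φ₁ φ₂ φ₃, IsKatoWeight β ε⁻¹ (fun x => (Real.exp (-β * x) + ε)⁻¹) φ₁ φ₂ φ₃ := by
  set φ : ℝ → ℝ := fun x => (Real.exp (-β * x) + ε)⁻¹ with hφ
  have hpos : ∀ x, 0 < φ x := fun x => by positivity
  have hle : ∀ x, φ x ≤ ε⁻¹ := fun x => by
    have := Real.exp_pos (-β * x)
    exact inv_anti₀ hε (by linarith)
  have hle1 : ∀ x, ε * φ x ≤ 1 := fun x => by
    have := mul_le_mul_of_nonneg_left (hle x) hε.le
    rwa [mul_inv_cancel₀ hε.ne'] at this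
  have hεφ : ∀ x, 0 < ε * φ x := fun x => mul_pos hε (hpos x)
  have hd0 : ∀ x, HasDerivAt φ (β * (φ x - ε * φ x ^ 2)) x := fun x => by
    have h := ((((hasDerivAt_id x).const_mul (-β)).exp).add_const ε).inv
      (show Real.exp (-β * id x) + ε ≠ 0 by positivity)
    refine h.congr_deriv ?_
    simp only [hφ, id]
    have : Real.exp (-β * x) + ε ≠ 0 := by positivity
    field_simp
    ring
  have hd1 : ∀ x, HasDerivAt (fun x => β * (φ x - ε * φ x ^ 2))
      (β * (1 - 2 * ε * φ x) * (β * (φ x - ε * φ x ^ 2))) x := fun x => by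
    refine (((hd0 x).sub (((hd0 x).fun_pow 2).const_mul ε)).const_mul β).congr_deriv ?_
    push_cast
    ring
  have hd2 : ∀ x, HasDerivAt (fun x => β * (1 - 2 * ε * φ x) * (β * (φ x - ε * φ x ^ 2)))
      (β ^ 3 * (φ x - ε * φ x ^ 2) * ((1 - 2 * ε * φ x) ^ 2 - 2 * ε * φ x * (1 - ε * φ x))) x :=
    fun x => by
    refine (((((hd0 x).const_mul (2 * ε)).const_sub 1).const_mul β).mul (hd1 x)).congr_deriv ?_
    ring
  have hcont : Continuous φ := continuous_iff_continuousAt.2 fun x => (hd0 x).continuousAt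
  have hq : ∀ x, 0 ≤ φ x - ε * φ x ^ 2 := fun x => by
    nlinarith [mul_nonneg (hpos x).le (sub_nonneg.2 (hle1 x))]
  have hq' : ∀ x, φ x - ε * φ x ^ 2 ≤ φ x := fun x => by
    nlinarith [mul_nonneg (hpos x).le (hεφ x).le]
  refine ⟨_, _, _, hd0, hd1, hd2, by fun_prop, fun x => (hpos x).le, hle, fun x => ?_,
    fun x => mul_nonneg hβ.le (hq x), fun x => mul_le_mul_of_nonneg_left (hq' x) hβ.le,
    fun x => ?_, fun x => ?_⟩
  · rw [show β * x = -(-β * x) by ring, Real.exp_neg]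
    exact inv_anti₀ (Real.exp_pos _) (by linarith)
  · have h1 : |1 - 2 * ε * φ x| ≤ 1 := abs_le.2 ⟨by linarith [hle1 x], by linarith [hεφ x]⟩
    calc |β * (1 - 2 * ε * φ x) * (β * (φ x - ε * φ x ^ 2))|
        = β ^ 2 * (|1 - 2 * ε * φ x| * (φ x - ε * φ x ^ 2)) := by
          rw [abs_mul, abs_mul, abs_mul, abs_of_pos hβ, abs_of_nonneg (hq x)]; ring
      _ ≤ β ^ 2 * (1 * φ x) := by
          have := hq x
          have := hq' x
          gcongr
      _ = β ^ 2 * φ x := by ring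
  · have h1 : (1 - 2 * ε * φ x) ^ 2 - 2 * ε * φ x * (1 - ε * φ x) ≤ 1 := by
      nlinarith [mul_nonneg (hεφ x).le (sub_nonneg.2 (hle1 x))]
    calc _ ≤ β ^ 3 * (φ x - ε * φ x ^ 2) * 1 :=
          mul_le_mul_of_nonneg_left h1 (mul_nonneg (by positivity) (hq x))
      _ ≤ β ^ 3 * φ x := by
          rw [mul_one]; exact mul_le_mul_of_nonneg_left (hq' x) (by positivity)

/-- The flux in the local weighted `L²` balance law of the equation, as a function of the weight
and of the solution and its first two space derivatives. -/
noncomputable def energyFlux (k : ℕ) (φ φ₁ φ₂ v v₁ v₂ : ℝ → ℝ) (x : ℝ) : ℝ :=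
  -(2 * v x * v₂ x * φ x) + v₁ x ^ 2 * φ x + 2 * v x * v₁ x * φ₁ x - v x ^ 2 * φ₂ x
    - 2 / (k + 2) * (v x ^ (k + 2) * φ x)

section Energy

variable {k : ℕ} {β P M : ℝ} {φ φ₁ φ₂ φ₃ v v₁ v₂ v₃ : ℝ → ℝ}

lemma hasDerivAt_energyFlux (hφ : IsKatoWeight β P φ φ₁ φ₂ φ₃)
    (h1 : ∀ x, HasDerivAt v (v₁ x) x) (h2 : ∀ x, HasDerivAt v₁ (v₂ x) x)
    (h3 : ∀ x, HasDerivAt v₂ (v₃ x) x) (x : ℝ) :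
    HasDerivAt (energyFlux k φ φ₁ φ₂ v v₁ v₂)
      (-(2 * v x * v₃ x * φ x) + 3 * v₁ x ^ 2 * φ₁ x - v x ^ 2 * φ₃ x
        - 2 * v x ^ (k + 1) * v₁ x * φ x - 2 / (k + 2) * (v x ^ (k + 2) * φ₁ x)) x := by
  have hk : (k + 2 : ℝ) ≠ 0 := by positivity
  refine (((((((((h1 x).const_mul 2).mul (h3 x)).mul (hφ.deriv₀ x)).neg.add
    (((h2 x).fun_pow 2).mul (hφ.deriv₀ x))).add
    ((((h1 x).const_mul 2).mul (h2 x)).mul (hφ.deriv₁ x))).sub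
    (((h1 x).fun_pow 2).mul (hφ.deriv₂ x))).sub
    ((((h1 x).fun_pow (k + 2)).mul (hφ.deriv₀ x)).const_mul (2 / (k + 2 : ℝ)))).congr_deriv ?_)
  rw [show k + 2 - 1 = k + 1 from rfl]
  simp only [Pi.mul_apply]
  push_cast
  field_simp
  ring

lemma abs_energyFlux_le (hβ : 0 ≤ β) (hφ : IsKatoWeight β P φ φ₁ φ₂ φ₃)
    (h0 : ∀ x, |v x| ≤ M) (h1 : ∀ x, |v₁ x| ≤ M) (h2 : ∀ x, |v₂ x| ≤ M) (x : ℝ) :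
    |energyFlux k φ φ₁ φ₂ v v₁ v₂ x| ≤
      P * (3 * M + 2 * M * β + M * β ^ 2 + M ^ (k + 1)) * (|v x| + |v₁ x|) := by
  have hM : 0 ≤ M := (abs_nonneg _).trans (h0 x)
  have hP := hφ.le_bound x
  have hp0 := hφ.nonneg x
  have hP0 : 0 ≤ P := hp0.trans hP
  have hφ1 : |φ₁ x| ≤ β * P := by
    rw [abs_of_nonneg (hφ.deriv_nonneg x)]
    exact (hφ.deriv_le x).trans (by gcongr)
  have hφ2 : |φ₂ x| ≤ β ^ 2 * P := (hφ.abs_deriv₁_le x).trans (by gcongr)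
  have hφ0 : |φ x| ≤ P := by rwa [abs_of_nonneg hp0]
  have a0 := h0 x
  have a1 := h1 x
  have a2 := h2 x
  have e1 : |-(2 * v x * v₂ x * φ x)| ≤ 2 * |v x| * M * P := by
    rw [abs_neg, abs_mul, abs_mul, abs_mul, abs_two]; gcongr
  have e2 : |v₁ x ^ 2 * φ x| ≤ |v₁ x| * M * P := by
    rw [sq, abs_mul, abs_mul]; gcongr
  have e3 : |2 * v x * v₁ x * φ₁ x| ≤ 2 * |v x| * M * (β * P) := by
    rw [abs_mul, abs_mul, abs_mul, abs_two]; gcongr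
  have e4 : |v x ^ 2 * φ₂ x| ≤ |v x| * M * (β ^ 2 * P) := by
    rw [sq, abs_mul, abs_mul]; gcongr
  have e5 : |2 / (k + 2) * (v x ^ (k + 2) * φ x)| ≤ 1 * (|v x| * M ^ (k + 1) * P) := by
    have : |(2 / (k + 2) : ℝ)| ≤ 1 := by
      rw [abs_of_nonneg (by positivity), div_le_one (by positivity)]
      linarith [(Nat.cast_nonneg k : (0 : ℝ) ≤ k)]
    rw [pow_succ' _ (k + 1), abs_mul, abs_mul, abs_mul, abs_pow]
    gcongr
  have n0 := abs_nonneg (v x)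
  have n1 := abs_nonneg (v₁ x)
  have hr : 0 ≤ P * (M + (2 * M * β + M * β ^ 2 + M ^ (k + 1))) * |v x| := by positivity
  have hs : 0 ≤ P * (2 * M + (2 * M * β + M * β ^ 2 + M ^ (k + 1))) * |v₁ x| := by positivity
  rw [energyFlux]
  rw [abs_le] at e1 e2 e3 e4 e5 ⊢
  constructor <;> nlinarith

lemma integral_energy_deriv_le (hβ : 0 ≤ β) (hφ : IsKatoWeight β P φ φ₁ φ₂ φ₃)
    (h1 : ∀ x, HasDerivAt v (v₁ x) x) (h2 : ∀ x, HasDerivAt v₁ (v₂ x) x)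
    (h3 : ∀ x, HasDerivAt v₂ (v₃ x) x) (hc : Continuous v₃) {w : ℝ → ℝ} (hw : Continuous w)
    (hpde : ∀ x, w x + v₃ x + v x ^ k * v₁ x = 0)
    (h0 : ∀ x, |v x| ≤ M) {a b : ℝ} (hab : a ≤ b) :
    ∫ x in a..b, 2 * v x * w x * φ x ≤
      energyFlux k φ φ₁ φ₂ v v₁ v₂ b - energyFlux k φ φ₁ φ₂ v v₁ v₂ a
        + (β ^ 3 + M ^ k * β) * ∫ x in a..b, v x ^ 2 * φ x := by
  have cont : ∀ {f f' : ℝ → ℝ}, (∀ x, HasDerivAt f (f' x) x) → Continuous f := fun h =>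
    continuous_iff_continuousAt.2 fun x => (h x).continuousAt
  have c0 := cont h1
  have c1 := cont h2
  have d0 := cont hφ.deriv₀
  have d1 := cont hφ.deriv₁
  have d3 := hφ.cont₃
  have hF := fun x => hasDerivAt_energyFlux (k := k) hφ h1 h2 h3 x
  have hFc : Continuous fun x => -(2 * v x * v₃ x * φ x) + 3 * v₁ x ^ 2 * φ₁ x - v x ^ 2 * φ₃ x
        - 2 * v x ^ (k + 1) * v₁ x * φ x - 2 / (k + 2 : ℝ) * (v x ^ (k + 2) * φ₁ x) := by
    fun_prop
  rw [← intervalIntegral.integral_eq_sub_of_hasDerivAt (fun x _ => hF x)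
    (hFc.intervalIntegrable _ _), ← intervalIntegral.integral_const_mul,
    ← intervalIntegral.integral_add (hFc.intervalIntegrable _ _)
      (Continuous.intervalIntegrable (by fun_prop) _ _)]
  refine intervalIntegral.integral_mono_on hab (Continuous.intervalIntegrable (by fun_prop) _ _)
    (Continuous.intervalIntegrable (by fun_prop) _ _) fun x _ => ?_
  have hM : 0 ≤ M := (abs_nonneg _).trans (h0 x)
  have e : w x = -v₃ x - v x ^ k * v₁ x := by linarith [hpde x]
  have t1 : 0 ≤ 3 * v₁ x ^ 2 * φ₁ x := by
    have := hφ.deriv_nonneg x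
    positivity
  have t2 : v x ^ 2 * φ₃ x ≤ v x ^ 2 * (β ^ 3 * φ x) :=
    mul_le_mul_of_nonneg_left (hφ.deriv₂_le x) (sq_nonneg _)
  have t3 : 2 / (k + 2) * (v x ^ (k + 2) * φ₁ x) ≤ 1 * (M ^ k * v x ^ 2 * (β * φ x)) := by
    have hk : (2 / (k + 2) : ℝ) ≤ 1 := by
      rw [div_le_one (by positivity)]
      linarith [(Nat.cast_nonneg k : (0 : ℝ) ≤ k)]
    have hpow : v x ^ (k + 2) ≤ M ^ k * v x ^ 2 := by
      rw [pow_add]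
      refine mul_le_mul_of_nonneg_right ?_ (sq_nonneg _)
      refine (le_abs_self _).trans ?_
      rw [abs_pow]
      exact pow_le_pow_left₀ (abs_nonneg _) (h0 x) k
    have h4 : v x ^ (k + 2) * φ₁ x ≤ M ^ k * v x ^ 2 * (β * φ x) := by
      have := hφ.deriv_nonneg x
      have := hφ.deriv_le x
      gcongr
    have h5 := hφ.nonneg x
    exact (mul_le_mul_of_nonneg_left h4 (by positivity)).trans
      (mul_le_mul_of_nonneg_right hk (by positivity))
  have e2 : 2 * v x * w x * φ x =
      -(2 * v x * v₃ x * φ x) - 2 * v x ^ (k + 1) * v₁ x * φ x := by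
    rw [e, pow_succ]; ring
  rw [e2]
  linarith

end Energy

/-- An `L²` bound on right half-lines together with a bound on the derivative gives a
pointwise bound. -/
lemma abs_pow_three_le {f f' : ℝ → ℝ} (hd : ∀ x, HasDerivAt f (f' x) x) (hc : Continuous f')
    {M B x : ℝ} (hM : ∀ x, |f' x| ≤ M) (h0 : Tendsto f atTop (𝓝 0))
    (hB : ∀ y, x ≤ y → ∫ z in x..y, f z ^ 2 ≤ B) : |f x| ^ 3 ≤ 3 * M * B := by
  have hf : Continuous f := continuous_iff_continuousAt.2 fun x => (hd x).continuousAt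
  have hM0 : 0 ≤ M := (abs_nonneg _).trans (hM x)
  have ht : Tendsto (fun y => |f y| ^ 3 + 3 * M * B) atTop (𝓝 (3 * M * B)) := by
    simpa using (h0.abs.pow 3).add_const (3 * M * B)
  refine ge_of_tendsto ht ((eventually_ge_atTop x).mono fun y hxy => ?_)
  have e := intervalIntegral.integral_eq_sub_of_hasDerivAt (a := x) (b := y)
    (fun z _ => (hd z).fun_pow 3) (Continuous.intervalIntegrable (by fun_prop) _ _)
  have hle : |∫ z in x..y, ((3 : ℕ) : ℝ) * f z ^ (3 - 1) * f' z| ≤ 3 * M * B := by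
    calc _ ≤ ∫ z in x..y, |((3 : ℕ) : ℝ) * f z ^ (3 - 1) * f' z| :=
          intervalIntegral.abs_integral_le_integral_abs hxy
      _ ≤ ∫ z in x..y, 3 * M * f z ^ 2 := by
          refine intervalIntegral.integral_mono_on hxy
            (Continuous.intervalIntegrable (by fun_prop) _ _)
            (Continuous.intervalIntegrable (by fun_prop) _ _) fun z _ => ?_
          rw [abs_mul, abs_mul, abs_of_nonneg (sq_nonneg (f z) : (0 : ℝ) ≤ f z ^ (3 - 1))]
          have := mul_le_mul_of_nonneg_left (hM z) (sq_nonneg (f z))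
          norm_num
          linarith
      _ ≤ 3 * M * B := by
          rw [intervalIntegral.integral_const_mul]
          exact mul_le_mul_of_nonneg_left (hB y hxy) (by positivity)
  rw [e] at hle
  rw [← abs_pow, ← abs_pow]
  have h := abs_sub_abs_le_abs_sub (f x ^ 3) (f y ^ 3)
  rw [abs_sub_comm] at h
  linarith

section Solution

variable {k : ℕ} {b A M : ℝ} {u : ℝ × ℝ → ℝ} (hu : ContDiff ℝ (⊤ : ℕ∞) u)
  (hL : ∀ t ∈ Icc (0 : ℝ) 1, ∀ n ≤ 4, Integrable (fun x => (pdx^[n] u) (x, t) ^ 2) ∧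
    ∫ x, (pdx^[n] u) (x, t) ^ 2 ≤ A ^ 2)

include hu in
lemma hasDerivAt_pdx_iterate (n : ℕ) (t x : ℝ) :
    HasDerivAt (fun y => (pdx^[n] u) (y, t)) ((pdx^[n + 1] u) (x, t)) x := by
  rw [Function.iterate_succ_apply']
  exact hasDerivAt_pdx (contDiff_pdx_iterate hu n) x t

include hu in
lemma continuous_pdx_iterate_slice (n : ℕ) (t : ℝ) : Continuous fun y => (pdx^[n] u) (y, t) :=
  (contDiff_pdx_iterate hu n).continuous.comp (continuous_id.prodMk continuous_const)

include hu hL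

lemma abs_pdx_iterate_le {t : ℝ} (ht : t ∈ Icc (0 : ℝ) 1) {n : ℕ} (hn : n ≤ 3) (x : ℝ) :
    |(pdx^[n] u) (x, t)| ≤ √(A ^ 2 + A ^ 2) := by
  obtain ⟨i0, j0⟩ := hL t ht n (by omega)
  obtain ⟨i1, j1⟩ := hL t ht (n + 1) (by omega)
  exact Real.abs_le_sqrt ((sq_le_integral_sq_add (hasDerivAt_pdx_iterate hu n t)
    (continuous_pdx_iterate_slice hu _ t) i0 i1 x).trans (add_le_add j0 j1))

lemma tendsto_pdx_iterate_atTop {t : ℝ} (ht : t ∈ Icc (0 : ℝ) 1) {n : ℕ} (hn : n ≤ 3) :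
    Tendsto (fun x => (pdx^[n] u) (x, t)) atTop (𝓝 0) :=
  tendsto_atTop_zero_of_sq_integrable (hasDerivAt_pdx_iterate hu n t)
    (continuous_pdx_iterate_slice hu _ t) (hL t ht n (by omega)).1 (hL t ht (n + 1) (by omega)).1

lemma tendsto_pdx_iterate_atBot {t : ℝ} (ht : t ∈ Icc (0 : ℝ) 1) {n : ℕ} (hn : n ≤ 3) :
    Tendsto (fun x => (pdx^[n] u) (x, t)) atBot (𝓝 0) :=
  tendsto_atBot_zero_of_sq_integrable (hasDerivAt_pdx_iterate hu n t)
    (continuous_pdx_iterate_slice hu _ t) (hL t ht n (by omega)).1 (hL t ht (n + 1) (by omega)).1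

variable (hpde : ∀ p : ℝ × ℝ, pdt u p + pdx (pdx (pdx u)) p + (u p) ^ k * pdx u p = 0)
  (hM : ∀ t ∈ Icc (0 : ℝ) 1, ∀ n ≤ 3, ∀ x, |(pdx^[n] u) (x, t)| ≤ M)

omit hL in
include hpde hM in
lemma weighted_integral_le_add_boundary {β P : ℝ} (hβ : 0 < β) {φ φ₁ φ₂ φ₃ : ℝ → ℝ}
    (hφ : IsKatoWeight β P φ φ₁ φ₂ φ₃) {D : ℝ}
    (hD : D = P * (3 * M + 2 * M * β + M * β ^ 2 + M ^ (k + 1))) {R : ℝ} (hR : 0 ≤ R) :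
    ∀ t ∈ Icc (0 : ℝ) 1, ∫ x in -R..R, u (x, t) ^ 2 * φ x ≤
      Real.exp (β ^ 3 + M ^ k * β) * ((∫ x in -R..R, u (x, 0) ^ 2 * φ x) +
        ∫ s in (0 : ℝ)..1, D * (|u (R, s)| + |pdx u (R, s)| + |u (-R, s)| + |pdx u (-R, s)|)) := by
  have hM0 : 0 ≤ M :=
    (abs_nonneg _).trans (hM 0 (left_mem_Icc.2 zero_le_one) 0 (by omega) 0)
  have hP0 : 0 ≤ P := (hφ.nonneg 0).trans (hφ.le_bound 0)
  have hD0 : 0 ≤ D := by rw [hD]; positivity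
  have cu : Continuous u := hu.continuous
  have cx : Continuous (pdx u) := (contDiff_pdx hu).continuous
  have ct := continuous_pdt hu
  have cφ : Continuous φ := continuous_iff_continuousAt.2 fun x => (hφ.deriv₀ x).continuousAt
  refine gronwall_of_deriv_le (E' := fun t => ∫ x in -R..R, 2 * u (x, t) * pdt u (x, t) * φ x)
    (by positivity) (fun t => ?_) (by fun_prop) (fun s => by positivity)
    (intervalIntegral.integral_nonneg (by linarith) fun x _ =>
      mul_nonneg (sq_nonneg _) (hφ.nonneg x)) fun t ht => ?_
  · refine hasDerivAt_intervalIntegral_of_continuous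
      (g := fun x t => u (x, t) ^ 2 * φ x)
      (g' := fun x t => 2 * u (x, t) * pdt u (x, t) * φ x) (by fun_prop) (by fun_prop)
      (fun x s => ?_) _ _ t
    simpa using ((hasDerivAt_pdt hu x s).fun_pow 2).mul_const (φ x)
  · have hd := hasDerivAt_pdx_iterate hu
    have key := integral_energy_deriv_le (k := k) (M := M) hβ.le hφ (hd 0 t) (hd 1 t) (hd 2 t)
      (continuous_pdx_iterate_slice hu 3 t) (w := fun x => pdt u (x, t)) (by fun_prop)
      (fun x => hpde (x, t)) (hM t ht 0 (by omega)) (show -R ≤ R by linarith)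
    have hF := abs_energyFlux_le (k := k) hβ.le hφ (hM t ht 0 (by omega)) (hM t ht 1 (by omega))
      (hM t ht 2 (by omega))
    rw [← hD] at hF
    have f1 := (le_abs_self _).trans (hF R)
    have f2 := (neg_le_abs _).trans (hF (-R))
    simp only [Function.iterate_zero, id, Function.iterate_one, zero_add, Nat.reduceAdd] at key f1 f2
    linarith

variable (hsupp : ∀ x : ℝ, b < x → u (x, 0) = 0)

include hpde hM hsupp

lemma weighted_integral_le {β P : ℝ} (hβ : 0 < β) {φ φ₁ φ₂ φ₃ : ℝ → ℝ}
    (hφ : IsKatoWeight β P φ φ₁ φ₂ φ₃) {t : ℝ} (ht : t ∈ Icc (0 : ℝ) 1) {x y : ℝ} (hxy : x ≤ y) :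
    ∫ z in x..y, u (z, t) ^ 2 * φ z ≤
      Real.exp (β ^ 3 + M ^ k * β) * (Real.exp (β * b) * A ^ 2) := by
  have h0 : (0 : ℝ) ∈ Icc (0 : ℝ) 1 := left_mem_Icc.2 zero_le_one
  have cu : Continuous u := hu.continuous
  have cx : Continuous (pdx u) := (contDiff_pdx hu).continuous
  have cφ : Continuous φ := continuous_iff_continuousAt.2 fun x => (hφ.deriv₀ x).continuousAt
  obtain ⟨D, hD⟩ : ∃ D, D = P * (3 * M + 2 * M * β + M * β ^ 2 + M ^ (k + 1)) := ⟨_, rfl⟩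
  have hM0 : 0 ≤ M := (abs_nonneg _).trans (hM 0 h0 0 (by omega) 0)
  have hP0 : 0 ≤ P := (hφ.nonneg 0).trans (hφ.le_bound 0)
  have hD0 : 0 ≤ D := by rw [hD]; positivity
  have hδ : Tendsto (fun R => ∫ s in (0 : ℝ)..1,
      D * (|u (R, s)| + |pdx u (R, s)| + |u (-R, s)| + |pdx u (-R, s)|)) atTop (𝓝 0) := by
    have h := intervalIntegral.tendsto_integral_filter_of_dominated_convergence (μ := volume)
      (a := 0) (b := 1) (l := atTop) (f := fun _ => (0 : ℝ))
      (F := fun R s => D * (|u (R, s)| + |pdx u (R, s)| + |u (-R, s)| + |pdx u (-R, s)|))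
      (fun _ => D * (M + M + M + M))
      (Eventually.of_forall fun R => Continuous.aestronglyMeasurable (by fun_prop))
      (Eventually.of_forall fun R => Eventually.of_forall fun s hs => ?_)
      intervalIntegrable_const (Eventually.of_forall fun s hs => ?_)
    · simpa using h
    · rw [uIoc_of_le zero_le_one] at hs
      have hs' := Ioc_subset_Icc_self hs
      have b0 := hM s hs' 0 (by omega)
      have b1 := hM s hs' 1 (by omega)
      simp only [Function.iterate_zero, id, Function.iterate_one] at b0 b1
      rw [Real.norm_of_nonneg (by positivity)]
      gcongr <;> apply_assumption
    · rw [uIoc_of_le zero_le_one] at hs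
      have hs' := Ioc_subset_Icc_self hs
      have l0 := (tendsto_pdx_iterate_atTop hu hL hs' (show 0 ≤ 3 by omega)).abs
      have l1 := (tendsto_pdx_iterate_atTop hu hL hs' (show 1 ≤ 3 by omega)).abs
      have l2 := ((tendsto_pdx_iterate_atBot hu hL hs' (show 0 ≤ 3 by omega)).comp
        tendsto_neg_atTop_atBot).abs
      have l3 := ((tendsto_pdx_iterate_atBot hu hL hs' (show 1 ≤ 3 by omega)).comp
        tendsto_neg_atTop_atBot).abs
      simpa using (((l0.add l1).add l2).add l3).const_mul D
  have hlim := (hδ.const_add (Real.exp (β * b) * A ^ 2)).const_mul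
    (Real.exp (β ^ 3 + M ^ k * β))
  rw [add_zero] at hlim
  refine ge_of_tendsto hlim ((eventually_ge_atTop (max |x| |y|)).mono fun R hR => ?_)
  have hRx : |x| ≤ R := (le_max_left _ _).trans hR
  have hRy : |y| ≤ R := (le_max_right _ _).trans hR
  have hR0 : 0 ≤ R := (abs_nonneg x).trans hRx
  have hinit : ∫ z in -R..R, u (z, 0) ^ 2 * φ z ≤ Real.exp (β * b) * A ^ 2 := by
    obtain ⟨i0, j0⟩ := hL 0 h0 0 (by omega)
    simp only [Function.iterate_zero, id] at i0 j0
    calc ∫ z in -R..R, u (z, 0) ^ 2 * φ z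
        ≤ ∫ z in -R..R, Real.exp (β * b) * u (z, 0) ^ 2 := by
          refine intervalIntegral.integral_mono_on (by linarith)
            (Continuous.intervalIntegrable (by fun_prop) _ _)
            (Continuous.intervalIntegrable (by fun_prop) _ _) fun z _ => ?_
          rcases lt_or_ge b z with hz | hz
          · simp [hsupp z hz]
          · rw [mul_comm]
            refine mul_le_mul_of_nonneg_right ((hφ.le_exp z).trans ?_) (sq_nonneg _)
            gcongr
      _ = Real.exp (β * b) * ∫ z in Ioc (-R) R, u (z, 0) ^ 2 := by
          rw [intervalIntegral.integral_const_mul,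
            intervalIntegral.integral_of_le (by linarith)]
      _ ≤ Real.exp (β * b) * A ^ 2 := by
          refine mul_le_mul_of_nonneg_left (le_trans ?_ j0) (Real.exp_pos _).le
          exact setIntegral_le_integral i0 (Eventually.of_forall fun z => sq_nonneg _)
  have h1 := weighted_integral_le_add_boundary hu hpde hM hβ hφ hD hR0 t ht
  have h2 : ∫ z in x..y, u (z, t) ^ 2 * φ z ≤ ∫ z in -R..R, u (z, t) ^ 2 * φ z :=
    intervalIntegral.integral_mono_interval (by linarith [neg_abs_le x]) hxy
      ((le_abs_self y).trans hRy)
      (Eventually.of_forall fun z => mul_nonneg (sq_nonneg _) (hφ.nonneg z))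
      (Continuous.intervalIntegrable (by fun_prop) _ _)
  refine (h2.trans h1).trans ?_
  gcongr

lemma integral_sq_le {β : ℝ} (hβ : 0 < β) {t : ℝ} (ht : t ∈ Icc (0 : ℝ) 1) {x y : ℝ}
    (hxy : x ≤ y) :
    ∫ z in x..y, u (z, t) ^ 2 ≤
      Real.exp (β ^ 3 + M ^ k * β) * (Real.exp (β * b) * A ^ 2) * Real.exp (-β * x) := by
  obtain ⟨B, hB⟩ : ∃ B, B = Real.exp (β ^ 3 + M ^ k * β) * (Real.exp (β * b) * A ^ 2) :=
    ⟨_, rfl⟩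
  rw [← hB]
  have cu : Continuous u := hu.continuous
  have hlim : Tendsto (fun ε => B * (Real.exp (-β * x) + ε)) (𝓝[>] 0)
      (𝓝 (B * Real.exp (-β * x))) := by
    have : Continuous fun ε => B * (Real.exp (-β * x) + ε) := by fun_prop
    simpa using (this.tendsto 0).mono_left nhdsWithin_le_nhds
  refine ge_of_tendsto hlim (eventually_nhdsWithin_of_forall fun ε (hε : 0 < ε) => ?_)
  obtain ⟨φ₁, φ₂, φ₃, hφ⟩ := exists_isKatoWeight hβ hε
  have h := weighted_integral_le hu hL hpde hM hsupp hβ hφ ht hxy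
  rw [← hB] at h
  have hpos : 0 < Real.exp (-β * x) + ε := by positivity
  rw [mul_comm, ← inv_mul_le_iff₀ hpos, ← intervalIntegral.integral_const_mul]
  have cφ : Continuous fun x => (Real.exp (-β * x) + ε)⁻¹ :=
    continuous_iff_continuousAt.2 fun x => (hφ.deriv₀ x).continuousAt
  refine le_trans (intervalIntegral.integral_mono_on hxy
    (Continuous.intervalIntegrable (by fun_prop) _ _)
    (Continuous.intervalIntegrable (by fun_prop) _ _) fun z hz => ?_) h
  rw [mul_comm]
  refine mul_le_mul_of_nonneg_left (inv_anti₀ (by positivity) ?_) (sq_nonneg _)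
  have : -β * z ≤ -β * x := by nlinarith [hz.1]
  gcongr

lemma exists_abs_le_exp {β : ℝ} (hβ : 0 < β) :
    ∃ c, ∀ t ∈ Icc (0 : ℝ) 1, ∀ x, |u (x, t)| ≤ c * Real.exp (-β * x) := by
  have hM0 : 0 ≤ M := (abs_nonneg _).trans
    (hM 0 (left_mem_Icc.2 zero_le_one) 0 (by omega) 0)
  obtain ⟨B, hB⟩ : ∃ B, B = Real.exp ((3 * β) ^ 3 + M ^ k * (3 * β)) *
    (Real.exp (3 * β * b) * A ^ 2) := ⟨_, rfl⟩
  have hB0 : 0 ≤ B := by rw [hB]; positivity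
  refine ⟨1 + 3 * M * B, fun t ht x => ?_⟩
  have h := abs_pow_three_le (hasDerivAt_pdx_iterate hu 0 t)
    (continuous_pdx_iterate_slice hu 1 t) (hM t ht 1 (by omega))
    (tendsto_pdx_iterate_atTop hu hL ht (by omega)) (x := x)
    (fun y hxy => integral_sq_le hu hL hpde hM hsupp (show 0 < 3 * β by positivity) ht hxy)
  simp only [Function.iterate_zero, id] at h
  rw [← hB, show Real.exp (-(3 * β) * x) = Real.exp (-β * x) ^ 3 by
    rw [← Real.exp_nat_mul]; congr 1; push_cast; ring] at h
  refine le_of_pow_le_pow_left₀ three_ne_zero (by positivity) (h.trans ?_)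
  have hK : 0 ≤ 3 * M * B := by positivity
  rw [mul_pow, ← mul_assoc]
  refine mul_le_mul_of_nonneg_right ?_ (by positivity)
  have := le_self_pow₀ (show 1 ≤ 1 + 3 * M * B by linarith) three_ne_zero
  linarith

end Solution

theorem stmt18 (k : ℕ) (hk : 0 < k) (b : ℝ) (u : ℝ × ℝ → ℝ)
    (hsmooth : ContDiff ℝ (⊤ : ℕ∞) u)
    (hH4 : ∃ A : ℝ, ∀ t ∈ Set.Icc (0:ℝ) 1, ∀ n ≤ 4,
      eLpNorm (fun x => iteratedDeriv n (fun y => u (y, t)) x) 2 volume ≤ ENNReal.ofReal A)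
    (hpde : ∀ p : ℝ × ℝ, pdt u p + pdx (pdx (pdx u)) p + (u p) ^ k * pdx u p = 0)
    (hsupp : ∀ x : ℝ, b < x → u (x, 0) = 0) :
    ∀ β : ℝ, 0 < β → ∃ c : ℝ, ∀ x : ℝ, 0 < x → ∀ t ∈ Set.Icc (0:ℝ) 1,
      |u (x, t)| + |pdx u (x, t)| + |pdx (pdx u) (x, t)| ≤ c * Real.exp (-β * x) := by
  intro β hβ
  obtain ⟨A, hA⟩ := hH4
  have hL : ∀ t ∈ Icc (0 : ℝ) 1, ∀ n ≤ 4, Integrable (fun x => (pdx^[n] u) (x, t) ^ 2) ∧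
      ∫ x, (pdx^[n] u) (x, t) ^ 2 ≤ (max A 0) ^ 2 := fun t ht n hn => by
    have h := hA t ht n hn
    rw [iteratedDeriv_slice] at h
    exact integrable_sq_and_integral_le (continuous_pdx_iterate_slice hsmooth n t)
      (le_max_right _ _) (h.trans (ENNReal.ofReal_le_ofReal (le_max_left _ _)))
  obtain ⟨M, hM⟩ : ∃ M, ∀ t ∈ Icc (0 : ℝ) 1, ∀ n ≤ 3, ∀ x, |(pdx^[n] u) (x, t)| ≤ M :=
    ⟨_, fun t ht n hn x => abs_pdx_iterate_le hsmooth hL ht hn x⟩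
  obtain ⟨c, hc⟩ := exists_abs_le_exp hsmooth hL hpde hM hsupp
    (show 0 < 2 * (2 * β) by positivity)
  have hd := hasDerivAt_pdx_iterate hsmooth
  refine ⟨c + (2 * c + M) + (2 * (2 * c + M) + M), fun x hx t ht => ?_⟩
  have h1 : ∀ x, |pdx u (x, t)| ≤ (2 * c + M) * Real.exp (-(2 * β) * x) := fun x =>
    abs_deriv_le_of_decay (hd 0 t) (hd 1 t) (hM t ht 2 (by omega)) (by positivity)
      (hc t ht) x
  have h2 : |pdx (pdx u) (x, t)| ≤ (2 * (2 * c + M) + M) * Real.exp (-β * x) :=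
    abs_deriv_le_of_decay (hd 1 t) (hd 2 t) (hM t ht 3 (by omega)) hβ.le h1 x
  have coef : ∀ {a e y : ℝ}, 0 < e → |y| ≤ a * e → 0 ≤ a := fun he h =>
    nonneg_of_mul_nonneg_left ((abs_nonneg _).trans h) he
  have c0 : 0 ≤ c := coef (Real.exp_pos _) (hc t ht x)
  have c1 : 0 ≤ 2 * c + M := coef (Real.exp_pos _) (h1 x)
  have hβx : 0 < β * x := mul_pos hβ hx
  have e0 : c * Real.exp (-(2 * (2 * β)) * x) ≤ c * Real.exp (-β * x) :=
    mul_le_mul_of_nonneg_left (Real.exp_le_exp.2 (by linarith)) c0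
  have e1 : (2 * c + M) * Real.exp (-(2 * β) * x) ≤ (2 * c + M) * Real.exp (-β * x) :=
    mul_le_mul_of_nonneg_left (Real.exp_le_exp.2 (by linarith)) c1
  linarith [hc t ht x, h1 x]
end
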